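/- arXiv:2302.12553 — 4 statements merged into one kernel-verified Lean document; each statement's English description precedes it below -/
import Mathlib

section
/- For every k ∈ N, every lattice polytope in the class P_k belongs to the class Q_k; that is, every face of dimension at least 2^k of a polytope in P_k has even normalized volume. -/
open Pointwise MeasureTheory

noncomputable section

/-- Standard dot product on `Fin n → ℝ`. -/
def dotR {n : ℕ} (c x : Fin n → ℝ) : ℝ := ∑ i, c i * x i

/-- The set of minimizers of the linear functional `x ↦ cᵀx` over `P`. -/
def argminSet {n : ℕ} (c : Fin n → ℝ) (P : Set (Fin n → ℝ)) : Set (Fin n → ℝ) :=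
  {x ∈ P | ∀ y ∈ P, dotR c x ≤ dotR c y}

/-- A polytope: the convex hull of a nonempty finite set of points. -/
def IsPolytope {n : ℕ} (P : Set (Fin n → ℝ)) : Prop :=
  ∃ V : Finset (Fin n → ℝ), V.Nonempty ∧ P = convexHull ℝ (V : Set (Fin n → ℝ))

/-- A lattice polytope: the convex hull of a nonempty finite set of integral points. -/
def IsLatticePolytope {n : ℕ} (P : Set (Fin n → ℝ)) : Prop :=
  ∃ V : Finset (Fin n → ℤ), V.Nonempty ∧
    P = convexHull ℝ ((fun v (i : Fin n) => ((v i : ℤ) : ℝ)) '' (V : Set (Fin n → ℤ)))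

/-- `F` is a face of `P`: either the empty face or the set of minimizers of a
linear functional over `P`. -/
def IsFace {n : ℕ} (P F : Set (Fin n → ℝ)) : Prop :=
  F = ∅ ∨ ∃ c : Fin n → ℝ, F = argminSet c P

/-- The dimension of a set: the rank of the direction space of its affine span. -/
def polyDim {n : ℕ} (P : Set (Fin n → ℝ)) : ℕ :=
  Module.finrank ℝ (affineSpan ℝ P).direction

/-- A point all of whose coordinates are integers. -/
def IsIntPt {m : ℕ} (x : Fin m → ℝ) : Prop := ∀ i, ∃ z : ℤ, x i = (z : ℝ)

/-- An affine chart identifying the affine hull of `P` with `ℝ^r` and mapping the induced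
lattice of integral points bijectively onto `ℤ^r`. -/
def IsLatticeChart {n r : ℕ} (P : Set (Fin n → ℝ))
    (φ : (Fin n → ℝ) →ᵃ[ℝ] (Fin r → ℝ)) : Prop :=
  Set.BijOn (fun x => φ x) (affineSpan ℝ P : Set (Fin n → ℝ)) Set.univ ∧
  ∀ x ∈ affineSpan ℝ P, (IsIntPt x ↔ IsIntPt (φ x))

open Classical in
/-- The normalized volume of a (rational) polytope `P`: `r!` times the Euclidean volume of
the image of `P` under a lattice-preserving affine chart of its affine hull (`r = dim P`).
This is well defined (independent of the chart) and integral for lattice polytopes. -/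
def normVol {n : ℕ} (P : Set (Fin n → ℝ)) : ℝ :=
  (Nat.factorial (polyDim P)) *
    (if h : ∃ φ : (Fin n → ℝ) →ᵃ[ℝ] (Fin (polyDim P) → ℝ), IsLatticeChart P φ
      then (volume ((fun x => h.choose x) '' P)).toReal
      else 0)

/-- The normalized volume is an even integer. -/
def EvenVol {n : ℕ} (P : Set (Fin n → ℝ)) : Prop := ∃ m : ℤ, normVol P = 2 * (m : ℝ)

/-- The class `Q_k`: lattice polytopes all of whose faces of dimension at least `2^k`
have even normalized volume. -/
def InQclass (k : ℕ) {n : ℕ} (P : Set (Fin n → ℝ)) : Prop :=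
  IsLatticePolytope P ∧ ∀ F, IsFace P F → 2 ^ k ≤ polyDim F → EvenVol F

/-- The classes `P_k` of lattice polytopes dual to `k`-hidden-layer integral ReLU networks:
`P_0` consists of single lattice points, and `P_{k+1}` consists of finite Minkowski sums of
convex hulls of unions of pairs of polytopes from `P_k`. -/
def InPclass {n : ℕ} : ℕ → Set (Fin n → ℝ) → Prop
  | 0, P => ∃ v : Fin n → ℤ, P = {fun i => ((v i : ℤ) : ℝ)}
  | k+1, P => ∃ (l : ℕ) (Q : Fin l → Set (Fin n → ℝ)), 0 < l ∧
      (∀ i, ∃ Q₁ Q₂ : Set (Fin n → ℝ), InPclass k Q₁ ∧ InPclass k Q₂ ∧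
        Q i = convexHull ℝ (Q₁ ∪ Q₂)) ∧
      P = ∑ i, Q i

/-- A (polyhedral) subdivision of `R`: a finite collection of polytopes covering `R`,
any two of which intersect in a common face. -/
def IsSubdivision {n : ℕ} (R : Set (Fin n → ℝ)) (𝒞 : Finset (Set (Fin n → ℝ))) : Prop :=
  (∀ C ∈ 𝒞, IsPolytope C) ∧
  (⋃ C ∈ 𝒞, C) = R ∧
  ∀ C ∈ 𝒞, ∀ D ∈ 𝒞, IsFace C (C ∩ D) ∧ IsFace D (C ∩ D)

/-- The standard simplex `Δ^n_0 = conv{0, e_1, …, e_n} ⊆ ℝ^n`. -/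
def stdSimplexPoly (n : ℕ) : Set (Fin n → ℝ) :=
  convexHull ℝ ({0} ∪ Set.range (fun i : Fin n => fun j => if j = i then (1 : ℝ) else 0))


theorem comb_mem {E : Type*} [AddCommGroup E] [Module ℝ E] {P : Set E} (hP : Convex ℝ P)
    {a b : ℝ} (ha : 0 ≤ a) (hb : 0 ≤ b) {p q : E} (hp : p ∈ P) (hq : q ∈ P) :
    ∃ r ∈ P, a • p + b • q = (a + b) • r := by
  have h : a • p + b • q ∈ (a + b) • P := by
    rw [hP.add_smul ha hb]
    exact Set.add_mem_add (Set.smul_mem_smul_set hp) (Set.smul_mem_smul_set hq)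
  obtain ⟨r, hr, h⟩ := h
  exact ⟨r, hr, h.symm⟩

theorem mem_hull_union {E : Type*} [AddCommGroup E] [Module ℝ E] {P Q : Set E}
    (hP : Convex ℝ P) (hQ : Convex ℝ Q) (hP' : P.Nonempty) (hQ' : Q.Nonempty) {x : E} :
    x ∈ convexHull ℝ (P ∪ Q) ↔
      ∃ s : ℝ, 0 ≤ s ∧ s ≤ 1 ∧ ∃ p ∈ P, ∃ q ∈ Q, x = (1 - s) • p + s • q := by
  rw [hP.convexHull_union hQ hP' hQ', mem_convexJoin]
  constructor
  · rintro ⟨p, hp, q, hq, a, b, ha, hb, hab, rfl⟩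
    exact ⟨b, hb, by linarith, p, hp, q, hq, by rw [← hab]; simp⟩
  · rintro ⟨s, h0, h1, p, hp, q, hq, rfl⟩
    exact ⟨p, hp, q, hq, 1 - s, s, by linarith, h0, by ring, rfl⟩

theorem hull_union_eq {E : Type*} [AddCommGroup E] [Module ℝ E] {P Q R : Set E}
    (hP : Convex ℝ P) (hQ : Convex ℝ Q) (hP' : P.Nonempty) (hQ' : Q.Nonempty) :
    (R + (convexHull ℝ (P ∪ Q) + P)) ∪ (R + (convexHull ℝ (P ∪ Q) + Q)) =
      R + (convexHull ℝ (P ∪ Q) + convexHull ℝ (P ∪ Q)) := by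
  have hPm : P ⊆ convexHull ℝ (P ∪ Q) := Set.subset_union_left.trans (subset_convexHull ℝ _)
  have hQm : Q ⊆ convexHull ℝ (P ∪ Q) := Set.subset_union_right.trans (subset_convexHull ℝ _)
  apply subset_antisymm
  · exact Set.union_subset (Set.add_subset_add_left (Set.add_subset_add_left hPm))
      (Set.add_subset_add_left (Set.add_subset_add_left hQm))
  · rintro z ⟨r, hr, w, ⟨x, hx, y, hy, rfl⟩, rfl⟩
    rw [mem_hull_union hP hQ hP' hQ'] at hx hy
    obtain ⟨s, hs0, hs1, p, hp, q, hq, rfl⟩ := hx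
    obtain ⟨t, ht0, ht1, p', hp', q', hq', rfl⟩ := hy
    obtain ⟨p2, hp2, e1⟩ := comb_mem hP (a := 1 - s) (b := 1 - t) (by linarith) (by linarith) hp hp'
    obtain ⟨q2, hq2, e2⟩ := comb_mem hQ hs0 ht0 hq hq'
    rcases le_total (s + t) 1 with h | h
    · left
      refine ⟨r, hr, _, ⟨(1 - (s + t)) • p2 + (s + t) • q2, ?_, p2, hp2, rfl⟩, ?_⟩
      · exact (mem_hull_union hP hQ hP' hQ').2 ⟨s + t, by linarith, h, p2, hp2, q2, hq2, rfl⟩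
      · linear_combination (norm := module) -e1 - e2
    · right
      refine ⟨r, hr, _, ⟨(1 - (s + t - 1)) • p2 + (s + t - 1) • q2, ?_, q2, hq2, rfl⟩, ?_⟩
      · exact (mem_hull_union hP hQ hP' hQ').2
          ⟨s + t - 1, by linarith, by linarith, p2, hp2, q2, hq2, rfl⟩
      · linear_combination (norm := module) -e1 - e2

theorem hull_inter_eq {E : Type*} [AddCommGroup E] [Module ℝ E] {P Q R : Set E}
    (hP : Convex ℝ P) (hQ : Convex ℝ Q) (hR : Convex ℝ R) (hP' : P.Nonempty) (hQ' : Q.Nonempty) :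
    (R + (convexHull ℝ (P ∪ Q) + P)) ∩ (R + (convexHull ℝ (P ∪ Q) + Q)) = R + (P + Q) := by
  have hPm : P ⊆ convexHull ℝ (P ∪ Q) := Set.subset_union_left.trans (subset_convexHull ℝ _)
  have hQm : Q ⊆ convexHull ℝ (P ∪ Q) := Set.subset_union_right.trans (subset_convexHull ℝ _)
  apply subset_antisymm
  · rintro z ⟨⟨r, hr, w, ⟨x, hx, p0, hp0, rfl⟩, rfl⟩, ⟨r', hr', w', ⟨y, hy, q0, hq0, rfl⟩, e⟩⟩
    rw [mem_hull_union hP hQ hP' hQ'] at hx hy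
    obtain ⟨s, hs0, hs1, p, hp, q, hq, rfl⟩ := hx
    obtain ⟨t, ht0, ht1, p', hp', q', hq', rfl⟩ := hy
    dsimp only at e ⊢
    obtain ⟨l, hl0, hl1, hl⟩ : ∃ l : ℝ, 0 ≤ l ∧ l ≤ 1 ∧ l * (1 - s + t) = t := by
      rcases eq_or_ne (1 - s + t) 0 with h | h
      · exact ⟨1, by norm_num, le_rfl, by linarith⟩
      · have hpos : 0 < 1 - s + t := lt_of_le_of_ne (by linarith) h.symm
        exact ⟨t / (1 - s + t), by positivity, by rw [div_le_one hpos]; linarith,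
          div_mul_cancel₀ _ h⟩
    have hl1' : 0 ≤ 1 - l := by linarith
    obtain ⟨p1, hp1, e1⟩ := comb_mem hP (a := 1 - s) (b := 1) (by linarith) (by linarith) hp hp0
    obtain ⟨q2, hq2, e2⟩ := comb_mem hQ (a := t) (b := 1) (by linarith) (by linarith) hq' hq0
    obtain ⟨r3, hr3, e3⟩ := comb_mem hR hl0 hl1' hr hr'
    obtain ⟨p3, hp3, e4⟩ := comb_mem hP (a := l * (1 - s + 1)) (b := (1 - l) * (1 - t))
      (mul_nonneg hl0 (by linarith)) (mul_nonneg hl1' (by linarith)) hp1 hp'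
    obtain ⟨q3, hq3, e5⟩ := comb_mem hQ (a := l * s) (b := (1 - l) * (t + 1))
      (mul_nonneg hl0 (by linarith)) (mul_nonneg hl1' (by linarith)) hq hq2
    rw [show l * (1 - s + 1) + (1 - l) * (1 - t) = 1 by linarith, one_smul] at e4
    rw [show l * s + (1 - l) * (t + 1) = 1 by linarith, one_smul] at e5
    rw [show l + (1 - l) = 1 by ring, one_smul] at e3
    refine ⟨r3, hr3, _, ⟨p3, hp3, q3, hq3, rfl⟩, ?_⟩
    dsimp only
    rw [← e3, ← e4, ← e5]
    linear_combination (norm := module) (-l) • e1 - (1 - l) • e2 + (1 - l) • e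
  · apply Set.subset_inter
    · rw [add_comm P Q]
      exact Set.add_subset_add_left (Set.add_subset_add_right hQm)
    · exact Set.add_subset_add_left (Set.add_subset_add_right hPm)

/-- The monoid of nonempty bounded convex sets. -/
def BC (n : ℕ) : AddSubmonoid (Set (Fin n → ℝ)) where
  carrier := {s | Convex ℝ s ∧ Bornology.IsBounded s ∧ s.Nonempty}
  zero_mem' := ⟨convex_singleton 0, Bornology.isBounded_singleton, Set.singleton_nonempty _⟩
  add_mem' := fun ha hb => ⟨ha.1.add hb.1, ha.2.1.add hb.2.1, ha.2.2.add hb.2.2⟩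

def cnt {n : ℕ} (s : Set (Fin n → ℝ)) : ℤ := (s ∩ {x | IsIntPt x}).ncard

theorem finite_int {n : ℕ} {s : Set (Fin n → ℝ)} (hs : Bornology.IsBounded s) :
    (s ∩ {x | IsIntPt x}).Finite := by
  obtain ⟨C, hC⟩ := hs.exists_norm_le
  refine ((Set.finite_Icc (fun _ : Fin n => -⌈C⌉) (fun _ : Fin n => ⌈C⌉)).image
    (fun v i => ((v i : ℤ) : ℝ))).subset ?_
  rintro x ⟨hx, hx'⟩
  choose v hv using hx'
  refine ⟨v, ?_, (funext hv).symm⟩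
  have h : ∀ i, |(v i : ℝ)| ≤ C := fun i => by
    rw [← hv i]; exact (norm_le_pi_norm x i).trans (hC x hx)
  constructor <;> intro i
  · have := (abs_le.1 (h i)).1
    have h2 := Int.le_ceil C
    have : (-⌈C⌉ : ℝ) ≤ v i := by linarith
    exact_mod_cast this
  · have := (abs_le.1 (h i)).2
    have h2 := Int.le_ceil C
    have : (v i : ℝ) ≤ ⌈C⌉ := by linarith
    exact_mod_cast this

theorem cnt_rel {n : ℕ} {P Q R : Set (Fin n → ℝ)} (hP : P ∈ BC n) (hQ : Q ∈ BC n) (hR : R ∈ BC n)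
    (hm : convexHull ℝ (P ∪ Q) ∈ BC n) :
    cnt (R + (convexHull ℝ (P ∪ Q) + convexHull ℝ (P ∪ Q))) + cnt (R + (P + Q)) =
    cnt (R + (convexHull ℝ (P ∪ Q) + P)) + cnt (R + (convexHull ℝ (P ∪ Q) + Q)) := by
  rw [← hull_union_eq hP.1 hQ.1 hP.2.2 hQ.2.2, ← hull_inter_eq hP.1 hQ.1 hR.1 hP.2.2 hQ.2.2]
  have h1 := finite_int (add_mem hR (add_mem hm hP)).2.1
  have h2 := finite_int (add_mem hR (add_mem hm hQ)).2.1
  have := Set.ncard_union_add_ncard_inter _ _ h1 h2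
  unfold cnt
  rw [Set.union_inter_distrib_right, Set.inter_inter_distrib_right]
  exact_mod_cast this

theorem cnt_translate {n : ℕ} (v : Fin n → ℤ) (R : Set (Fin n → ℝ)) :
    cnt (R + {fun i => ((v i : ℤ) : ℝ)}) = cnt R := by
  unfold cnt
  have : (R + {fun i => ((v i : ℤ) : ℝ)}) ∩ {x | IsIntPt x} =
      (fun x => x + fun i => ((v i : ℤ) : ℝ)) '' (R ∩ {x | IsIntPt x}) := by
    rw [Set.add_singleton]
    ext x
    constructor
    · rintro ⟨⟨y, hy, rfl⟩, h⟩
      refine ⟨y, ⟨hy, fun i => ?_⟩, rfl⟩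
      obtain ⟨z, hz⟩ := h i
      exact ⟨z - v i, by push_cast; rw [← hz]; simp⟩
    · rintro ⟨y, ⟨hy, h⟩, rfl⟩
      refine ⟨⟨y, hy, rfl⟩, fun i => ?_⟩
      obtain ⟨z, hz⟩ := h i
      exact ⟨z + v i, by push_cast; rw [← hz]; simp⟩
  rw [this, Set.ncard_image_of_injective _ (add_left_injective _)]

abbrev AA (n : ℕ) := AddMonoidAlgebra ℤ (BC n)

def lin {n : ℕ} : AA n →+ ℤ where
  toFun (a : AA n) := a.coeff.sum (fun P z => z * cnt (P : Set (Fin n → ℝ)))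
  map_zero' := by simp
  map_add' a b := by
    rw [AddMonoidAlgebra.coeff_add, Finsupp.sum_add_index'] <;> intros <;> ring

theorem lin_single {n : ℕ} (P : BC n) (z : ℤ) :
    lin (AddMonoidAlgebra.single P z) = z * cnt (P : Set (Fin n → ℝ)) := by
  show Finsupp.sum (AddMonoidAlgebra.single P z).coeff
    (fun (P : BC n) (z : ℤ) => z * cnt (P : Set (Fin n → ℝ))) = _
  rw [AddMonoidAlgebra.coeff_single, Finsupp.sum_single_index]; ring

def II (n : ℕ) : Ideal (AA n) where
  carrier := {a | ∀ b, lin (b * a) = 0}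
  zero_mem' := by simp
  add_mem' := by intro a b ha hb c; rw [mul_add, map_add, ha, hb, add_zero]
  smul_mem' := by intro c a ha b; rw [smul_eq_mul, ← mul_assoc]; exact ha _

theorem mem_II {n : ℕ} (a : AA n)
    (h : ∀ R : BC n, lin (AddMonoidAlgebra.single R 1 * a) = 0) : a ∈ II n := by
  intro b
  induction b using AddMonoidAlgebra.induction_linear with
  | zero => simp
  | add f g hf hg => rw [add_mul, map_add, hf, hg, add_zero]
  | single R z =>
    have : (AddMonoidAlgebra.single R z : AA n) = z • AddMonoidAlgebra.single R 1 := by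
      rw [AddMonoidAlgebra.smul_single]; simp
    rw [this, smul_mul_assoc, map_zsmul, h, smul_zero]

def el {n : ℕ} (P : BC n) : AA n ⧸ II n := Ideal.Quotient.mk _ (AddMonoidAlgebra.single P 1)

theorem el_add {n : ℕ} (P Q : BC n) : el (P + Q) = el P * el Q := by
  unfold el
  rw [← map_mul, AddMonoidAlgebra.single_mul_single, one_mul]

theorem el_zero {n : ℕ} : el (0 : BC n) = 1 := by
  unfold el
  rw [← AddMonoidAlgebra.one_def, map_one]

def Good {n : ℕ} (k : ℕ) (P : Set (Fin n → ℝ)) : Prop :=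
  ∃ h : P ∈ BC n, IsNilpotent (el ⟨P, h⟩ - 1) ∧ (2 : AA n ⧸ II n) ∣ el ⟨P, h⟩ ^ 2 ^ k - 1

theorem good_pt {n : ℕ} (v : Fin n → ℤ) : Good 0 ({fun i => ((v i : ℤ) : ℝ)} : Set (Fin n → ℝ)) := by
  have h : ({fun i => ((v i : ℤ) : ℝ)} : Set (Fin n → ℝ)) ∈ BC n :=
    ⟨convex_singleton _, Bornology.isBounded_singleton, Set.singleton_nonempty _⟩
  have : el ⟨_, h⟩ = 1 := by
    rw [← el_zero]
    unfold el
    rw [Ideal.Quotient.eq]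
    apply mem_II
    intro R
    rw [mul_sub, map_sub, AddMonoidAlgebra.single_mul_single, AddMonoidAlgebra.single_mul_single,
      lin_single, lin_single]
    show 1 * 1 * cnt ((R : Set (Fin n → ℝ)) + _) - 1 * 1 * cnt ((R + 0 : BC n) : Set (Fin n → ℝ)) = 0
    rw [cnt_translate, add_zero, sub_self]
  exact ⟨h, by rw [this]; simp, by rw [this]; simp⟩

theorem good_add {n : ℕ} (k : ℕ) (P Q : Set (Fin n → ℝ)) (hP : Good k P) (hQ : Good k Q) :
    Good k (P + Q) := by
  obtain ⟨h1, n1, d1⟩ := hP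
  obtain ⟨h2, n2, d2⟩ := hQ
  refine ⟨add_mem h1 h2, ?_⟩
  rw [show (⟨P + Q, add_mem h1 h2⟩ : BC n) = ⟨P, h1⟩ + ⟨Q, h2⟩ from rfl, el_add]
  generalize el ⟨P, h1⟩ = x at *
  generalize el ⟨Q, h2⟩ = y at *
  constructor
  · rw [show x * y - 1 = (x - 1) * y + (y - 1) by ring, ← mem_nilradical]
    exact add_mem (Ideal.mul_mem_right _ _ n1) n2
  · obtain ⟨u, hu⟩ := d1
    obtain ⟨v, hv⟩ := d2
    rw [mul_pow, eq_add_of_sub_eq hu, eq_add_of_sub_eq hv]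
    exact ⟨2 * u * v + u + v, by ring⟩

theorem good_zero {n : ℕ} (k : ℕ) : Good k (0 : Set (Fin n → ℝ)) := by
  refine ⟨zero_mem _, ?_⟩
  rw [show (⟨0, zero_mem _⟩ : BC n) = 0 from rfl, el_zero]
  simp

theorem good_hull {n : ℕ} (k : ℕ) (P Q : Set (Fin n → ℝ)) (hP : Good k P) (hQ : Good k Q) :
    Good (k+1) (convexHull ℝ (P ∪ Q)) := by
  obtain ⟨h1, n1, d1⟩ := hP
  obtain ⟨h2, n2, d2⟩ := hQ
  have hm : convexHull ℝ (P ∪ Q) ∈ BC n := ⟨convex_convexHull _ _,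
    isBounded_convexHull.2 (h1.2.1.union h2.2.1), (h1.2.2.inl).convexHull⟩
  refine ⟨hm, ?_⟩
  have rel : el ⟨_, hm⟩ ^ 2 + el ⟨P, h1⟩ * el ⟨Q, h2⟩ =
      el ⟨_, hm⟩ * el ⟨P, h1⟩ + el ⟨_, hm⟩ * el ⟨Q, h2⟩ := by
    rw [sq, ← el_add, ← el_add, ← el_add, ← el_add]
    unfold el
    rw [← map_add, ← map_add, Ideal.Quotient.eq]
    apply mem_II
    intro R
    rw [mul_sub, map_sub, mul_add, mul_add, map_add, map_add]
    simp only [AddMonoidAlgebra.single_mul_single, lin_single, one_mul]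
    rw [sub_eq_zero]
    exact cnt_rel h1 h2 R.2 hm
  generalize el ⟨P, h1⟩ = p at *
  generalize el ⟨Q, h2⟩ = q at *
  generalize el ⟨_, hm⟩ = m at *
  constructor
  · have : (m - 1) ^ 2 ∈ nilradical (AA n ⧸ II n) := by
      rw [show (m - 1) ^ 2 = (m - 1) * (p - 1) + ((m - 1) - (p - 1)) * (q - 1) by
        linear_combination rel]
      exact add_mem (Ideal.mul_mem_left _ _ n1) (Ideal.mul_mem_left _ _ n2)
    exact IsNilpotent.of_pow this
  · obtain ⟨u, hu⟩ := d1
    obtain ⟨v, hv⟩ := d2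
    obtain ⟨r, hr⟩ := exists_add_pow_prime_pow_eq Nat.prime_two (m ^ 2) (p * q) k
    obtain ⟨s, hs⟩ := exists_add_pow_prime_pow_eq Nat.prime_two (m * p) (m * q) k
    rw [rel, hs, mul_pow, mul_pow, mul_pow, eq_add_of_sub_eq hu, eq_add_of_sub_eq hv,
      ← pow_mul, ← pow_succ'] at hr
    push_cast at hr
    exact ⟨m ^ 2 ^ k * (1 + u + v) + m ^ 2 * p * q * (s - r) - 2 * u * v - u - v - 1, by linear_combination -hr⟩

theorem good_of_InP {n : ℕ} (k : ℕ) : ∀ (P : Set (Fin n → ℝ)), InPclass k P → Good k P := by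
  induction k with
  | zero => rintro P ⟨v, rfl⟩; exact good_pt v
  | succ k ih =>
    rintro P ⟨l, Q, -, hQ, rfl⟩
    refine Finset.sum_induction Q (Good (k+1)) (good_add _) (good_zero _) ?_
    intro i _
    obtain ⟨Q₁, Q₂, h1, h2, e⟩ := hQ i
    rw [e]
    exact good_hull k _ _ (ih _ h1) (ih _ h2)

open Filter Topology in
theorem choose_lim (i e : ℕ) (h : i ≤ e) :
    Tendsto (fun j : ℕ => (j.choose i : ℝ) / (j : ℝ) ^ e) atTop
      (𝓝 (if i = e then 1 / (e.factorial : ℝ) else 0)) := by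
  have key : Tendsto (fun j : ℕ => (j.choose i : ℝ) / (j : ℝ) ^ i) atTop
      (𝓝 (1 / (i.factorial : ℝ))) := by
    have h1 := (isEquivalent_choose i).div
      (Asymptotics.IsEquivalent.refl (u := fun j : ℕ => (j : ℝ) ^ i) (l := atTop))
    refine h1.symm.tendsto_nhds ?_
    refine tendsto_const_nhds.congr' ?_
    filter_upwards [eventually_gt_atTop 0] with j hj
    have : (j : ℝ) ≠ 0 := by positivity
    simp only [Pi.div_apply]
    field_simp
  split_ifs with hie
  · subst hie; exact key
  · have h2 : Tendsto (fun j : ℕ => ((j : ℝ) ^ (e - i))⁻¹) atTop (𝓝 0) :=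
      tendsto_inv_atTop_zero.comp
        ((tendsto_pow_atTop (by omega)).comp tendsto_natCast_atTop_atTop)
    have h3 := key.mul h2
    rw [mul_zero] at h3
    refine h3.congr fun j => ?_
    rw [← div_eq_mul_inv, div_div, ← pow_add, Nat.add_sub_cancel' h]

open Filter Topology in
theorem sum_lim (a : ℕ → ℤ) (e : ℕ) :
    Tendsto (fun j : ℕ => (∑ i ∈ Finset.range (e + 1), (j.choose i : ℝ) * a i) / (j : ℝ) ^ e) atTop
      (𝓝 (a e / (e.factorial : ℝ))) := by
  have : ∀ i ∈ Finset.range (e + 1), Tendsto (fun j : ℕ => (j.choose i : ℝ) / (j : ℝ) ^ e * a i) atTop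
      (𝓝 ((if i = e then 1 / (e.factorial : ℝ) else 0) * a i)) := fun i hi =>
    (choose_lim i e (by simpa [Nat.lt_succ_iff] using hi)).mul_const _
  have h := tendsto_finsetSum _ this
  have e1 : ∑ i ∈ Finset.range (e + 1), (if i = e then 1 / (e.factorial : ℝ) else 0) * a i =
      a e / (e.factorial : ℝ) := by
    simp only [ite_mul, zero_mul]
    rw [Finset.sum_ite_eq' (Finset.range (e+1)) e]
    simp; ring
  rw [e1] at h
  refine h.congr fun j => ?_
  rw [Finset.sum_div]
  exact Finset.sum_congr rfl fun i _ => by ring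

open Filter Topology in
theorem lim_coeff (a : ℕ → ℤ) (d : ℕ) (V : ℝ) (N : ℕ) :
    Tendsto (fun j : ℕ => (∑ i ∈ Finset.range (d + 1 + N), (j.choose i : ℝ) * a i) / (j : ℝ) ^ d) atTop
      (𝓝 V) → (a d : ℝ) = d.factorial * V := by
  induction N with
  | zero =>
    intro h
    have := tendsto_nhds_unique h (sum_lim a d)
    rw [this]; field_simp
  | succ N ih =>
    intro h
    apply ih
    have h2 : Tendsto (fun j : ℕ => ((j : ℝ) ^ (N + 1))⁻¹) atTop (𝓝 0) :=
      tendsto_inv_atTop_zero.comp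
        ((tendsto_pow_atTop (by omega)).comp tendsto_natCast_atTop_atTop)
    have h3 := h.mul h2
    rw [mul_zero] at h3
    have h4 := sum_lim a (d + 1 + N)
    have h5 : (a (d + 1 + N) : ℝ) / ((d + 1 + N).factorial : ℝ) = 0 := by
      refine tendsto_nhds_unique h4 (h3.congr fun j => ?_)
      rw [div_mul_eq_mul_div, ← div_eq_mul_inv, div_div, ← pow_add]
      congr 2
      ring
    have h6 : (a (d + 1 + N) : ℝ) = 0 := by
      have : ((d + 1 + N).factorial : ℝ) ≠ 0 := by positivity
      field_simp at h5; simpa using h5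
    refine h.congr fun j => ?_
    rw [← add_assoc, Finset.sum_range_succ, h6, mul_zero, add_zero]

theorem coe_nsmul_BC {n : ℕ} (P : BC n) (j : ℕ) (hj : 0 < j) :
    ((j • P : BC n) : Set (Fin n → ℝ)) = (j : ℝ) • (P : Set (Fin n → ℝ)) := by
  induction j, hj using Nat.le_induction with
  | base => simp
  | succ j hj ih =>
    rw [succ_nsmul, AddSubmonoid.coe_add, ih, Nat.cast_succ,
      P.2.1.add_smul (by positivity) zero_le_one, one_smul]

theorem good_count {n : ℕ} (k : ℕ) (P : Set (Fin n → ℝ)) (hP : Good k P) :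
    ∃ (a : ℕ → ℤ) (M : ℕ), (∀ i, M ≤ i → a i = 0) ∧ (∀ i, 2 ^ k ≤ i → 2 ∣ a i) ∧
      ∀ j : ℕ, 0 < j → cnt ((j : ℝ) • P) = ∑ i ∈ Finset.range (j + 1), (j.choose i : ℤ) * a i := by
  obtain ⟨h, ⟨M, hM⟩, u, hu⟩ := hP
  set X : AA n := AddMonoidAlgebra.single ⟨P, h⟩ 1 with hX
  have hel : el ⟨P, h⟩ = Ideal.Quotient.mk (II n) X := rfl
  have hI : ∀ a ∈ II n, lin a = 0 := fun a ha => by simpa using ha 1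
  refine ⟨fun i => lin ((X - 1) ^ i), M, ?_, ?_, ?_⟩
  · intro i hi
    apply hI
    rw [← Ideal.Quotient.eq_zero_iff_mem, map_pow, map_sub, map_one, ← hel]
    exact pow_eq_zero_of_le hi hM
  · intro i hi
    obtain ⟨r, hr⟩ := exists_add_pow_prime_pow_eq Nat.prime_two (el ⟨P, h⟩ - 1) 1 k
    rw [sub_add_cancel, one_pow] at hr
    have hd : (2 : AA n ⧸ II n) ∣ (el ⟨P, h⟩ - 1) ^ i := by
      refine Dvd.dvd.trans ?_ (pow_dvd_pow _ hi)
      refine ⟨u - (el ⟨P, h⟩ - 1) * r, ?_⟩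
      push_cast at hr
      linear_combination hu - hr
    obtain ⟨y, hy⟩ := hd
    obtain ⟨y, rfl⟩ := Ideal.Quotient.mk_surjective y
    have : (X - 1) ^ i - (y + y) ∈ II n := by
      rw [← Ideal.Quotient.eq_zero_iff_mem, map_sub, map_pow, map_sub, map_one, ← hel, hy, map_add]
      ring
    have := hI _ this
    rw [map_sub, map_add] at this
    exact ⟨lin y, by linarith⟩
  · intro j hj
    have e1 : lin (X ^ j) = cnt ((j : ℝ) • P) := by
      rw [hX, AddMonoidAlgebra.single_pow, lin_single, one_pow, one_mul, coe_nsmul_BC _ _ hj]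
    rw [← e1]
    conv_lhs => rw [← sub_add_cancel X 1, add_pow]
    rw [map_sum]
    refine Finset.sum_congr rfl fun i _ => ?_
    rw [one_pow, mul_one, mul_comm, ← nsmul_eq_mul, map_nsmul, nsmul_eq_mul]

theorem isInt_sub {d : ℕ} {x y : Fin d → ℝ} (hx : IsIntPt x) (hy : IsIntPt y) : IsIntPt (x - y) :=
  fun i => by
    obtain ⟨a, ha⟩ := hx i
    obtain ⟨b, hb⟩ := hy i
    exact ⟨a - b, by simp [ha, hb]⟩

theorem isInt_smul {d : ℕ} {x : Fin d → ℝ} (m : ℤ) (hx : IsIntPt x) : IsIntPt ((m : ℝ) • x) :=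
  fun i => by
    obtain ⟨a, ha⟩ := hx i
    exact ⟨m * a, by simp [ha]⟩

theorem isInt_aux {d : ℕ} (v w : Fin d → ℝ) (hv : IsIntPt v) (j : ℕ) :
    IsIntPt (AffineMap.lineMap v w (j : ℝ)) ↔ IsIntPt ((j : ℝ) • w) := by
  have e : AffineMap.lineMap v w (j : ℝ) = (j : ℝ) • w - (((j : ℤ) - 1 : ℤ) : ℝ) • v := by
    rw [AffineMap.lineMap_apply_module]; push_cast; module
  constructor
  · intro h
    have e2 : (j : ℝ) • w = AffineMap.lineMap v w (j : ℝ) - ((1 - (j : ℤ) : ℤ) : ℝ) • v := by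
      rw [e]; push_cast; module
    rw [e2]; exact isInt_sub h (isInt_smul _ hv)
  · intro h
    rw [e]; exact isInt_sub h (isInt_smul _ hv)

theorem chart_count {n d : ℕ} (P : Set (Fin n → ℝ)) (φ : (Fin n → ℝ) →ᵃ[ℝ] (Fin d → ℝ))
    (hφ : IsLatticeChart P φ) (v : Fin n → ℝ) (hv : v ∈ P) (hvi : IsIntPt v) (j : ℕ) (hj : 0 < j) :
    cnt ((j : ℝ) • P) = Nat.card ↑(((fun x => φ x) '' P) ∩
      (j : ℝ)⁻¹ • (Submodule.span ℤ (Set.range (Pi.basisFun ℝ (Fin d))) : Set (Fin d → ℝ))) := by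
  have hj0 : (j : ℝ) ≠ 0 := by positivity
  have hsub : P ⊆ affineSpan ℝ P := subset_affineSpan ℝ P
  have hφv : IsIntPt (φ v) := (hφ.2 v (hsub hv)).1 hvi
  have key : ∀ w ∈ P, IsIntPt ((j : ℝ) • w) ↔ IsIntPt ((j : ℝ) • φ w) := by
    intro w hw
    rw [← isInt_aux v w hvi, ← isInt_aux (φ v) (φ w) hφv, ← AffineMap.apply_lineMap]
    exact hφ.2 _ (AffineMap.lineMap_mem _ (hsub hv) (hsub hw))
  have e1 : ((j : ℝ) • P) ∩ {x | IsIntPt x} =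
      (fun w => (j : ℝ) • w) '' (P ∩ {w | IsIntPt ((j : ℝ) • w)}) := by
    ext x
    constructor
    · rintro ⟨⟨w, hw, rfl⟩, h⟩
      exact ⟨w, ⟨hw, h⟩, rfl⟩
    · rintro ⟨w, ⟨hw, h⟩, rfl⟩
      exact ⟨⟨w, hw, rfl⟩, h⟩
  have e2 : ((fun x => φ x) '' P) ∩
      (j : ℝ)⁻¹ • (Submodule.span ℤ (Set.range (Pi.basisFun ℝ (Fin d))) : Set (Fin d → ℝ)) =
      (fun x => φ x) '' (P ∩ {w | IsIntPt ((j : ℝ) • w)}) := by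
    have hmem : ∀ y : Fin d → ℝ, y ∈ (j : ℝ)⁻¹ •
        (Submodule.span ℤ (Set.range (Pi.basisFun ℝ (Fin d))) : Set (Fin d → ℝ)) ↔
        IsIntPt ((j : ℝ) • y) := by
      intro y
      rw [Set.mem_inv_smul_set_iff₀ hj0, SetLike.mem_coe, (Pi.basisFun ℝ (Fin d)).mem_span_iff_repr_mem ℤ]
      simp [IsIntPt, eq_comm]
    ext y
    constructor
    · rintro ⟨⟨w, hw, rfl⟩, h⟩
      exact ⟨w, ⟨hw, (key w hw).2 ((hmem _).1 h)⟩, rfl⟩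
    · rintro ⟨w, ⟨hw, h⟩, rfl⟩
      exact ⟨⟨w, hw, rfl⟩, (hmem _).2 ((key w hw).1 h)⟩
  unfold cnt
  rw [e1, e2, Nat.card_coe_set_eq, Set.ncard_image_of_injective _ (smul_right_injective _ hj0),
    Set.InjOn.ncard_image]
  exact hφ.1.injOn.mono (Set.inter_subset_left.trans hsub)

open Filter Topology in
theorem evenVol_of_good {n : ℕ} (k : ℕ) (P : Set (Fin n → ℝ)) (hP : Good k P)
    (hL : IsLatticePolytope P) (hd : 2 ^ k ≤ polyDim P) : EvenVol P := by
  unfold EvenVol normVol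
  split_ifs with h
  swap
  · exact ⟨0, by simp⟩
  generalize h.choose = φ, h.choose_spec = hφ
  obtain ⟨a, M, ha, ha2, hc⟩ := good_count k P hP
  obtain ⟨V, ⟨v0, hv0⟩, hPV⟩ := hL
  have hPc : IsCompact P := by
    rw [hPV]; exact ((V.finite_toSet).image _).isCompact_convexHull ℝ
  have hv : (fun i => ((v0 i : ℤ) : ℝ)) ∈ P := by
    rw [hPV]; exact subset_convexHull _ _ ⟨v0, hv0, rfl⟩
  have hvi : IsIntPt (fun i => ((v0 i : ℤ) : ℝ)) := fun i => ⟨v0 i, rfl⟩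
  have hcpt : IsCompact ((fun x => φ x) '' P) :=
    hPc.image φ.continuous_of_finiteDimensional
  have hconv : Convex ℝ ((fun x => φ x) '' P) := hP.1.1.affine_image φ
  have lim := tendsto_card_div_pow_atTop_volume _ hcpt.isBounded hcpt.measurableSet
    (hconv.addHaar_frontier volume)
  obtain ⟨m, hm⟩ := ha2 _ hd
  refine ⟨m, ?_⟩
  have hlim := lim_coeff a (polyDim P) (volume.real ((fun x => φ x) '' P)) M (by
    refine lim.congr' ?_
    filter_upwards [eventually_gt_atTop 0] with j hj
    have h1 := chart_count P φ hφ _ hv hvi j hj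
    rw [hc j hj] at h1
    have h2 : ∑ i ∈ Finset.range (j + 1), (j.choose i : ℤ) * a i =
        ∑ i ∈ Finset.range (polyDim P + 1 + M), (j.choose i : ℤ) * a i := by
      trans ∑ i ∈ Finset.range (max (j + 1) (polyDim P + 1 + M)), (j.choose i : ℤ) * a i
      · refine Finset.sum_subset (Finset.range_mono (le_max_left _ _)) fun i _ hi => ?_
        rw [Nat.choose_eq_zero_of_lt (by simpa using hi)]; simp
      · refine (Finset.sum_subset (Finset.range_mono (le_max_right _ _)) fun i _ hi => ?_).symm
        rw [ha i (by simp at hi; omega), mul_zero]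
    rw [h2] at h1
    rw [Fintype.card_fin]
    congr 1
    have h3 := congrArg (Int.cast : ℤ → ℝ) h1
    push_cast at h3
    exact h3.symm)
  rw [hm] at hlim
  push_cast at hlim
  exact hlim.symm

theorem latt_add {n : ℕ} (P Q : Set (Fin n → ℝ)) (hP : IsLatticePolytope P)
    (hQ : IsLatticePolytope Q) : IsLatticePolytope (P + Q) := by
  classical
  obtain ⟨V, hV, rfl⟩ := hP
  obtain ⟨W, hW, rfl⟩ := hQ
  refine ⟨V + W, hV.add hW, ?_⟩
  rw [← convexHull_add]
  congr 1
  ext x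
  constructor
  · rintro ⟨_, ⟨v, hv, rfl⟩, _, ⟨w, hw, rfl⟩, rfl⟩
    exact ⟨v + w, by simpa using Set.add_mem_add hv hw, by ext i; simp⟩
  · rintro ⟨y, hy, rfl⟩
    rw [Finset.coe_add] at hy
    obtain ⟨v, hv, w, hw, rfl⟩ := hy
    exact ⟨_, ⟨v, hv, rfl⟩, _, ⟨w, hw, rfl⟩, by ext i; simp⟩

theorem latt_pt {n : ℕ} (v : Fin n → ℤ) :
    IsLatticePolytope ({fun i => ((v i : ℤ) : ℝ)} : Set (Fin n → ℝ)) :=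
  ⟨{v}, by simp, by simp⟩

theorem latt_hull {n : ℕ} (P Q : Set (Fin n → ℝ)) (hP : IsLatticePolytope P)
    (hQ : IsLatticePolytope Q) : IsLatticePolytope (convexHull ℝ (P ∪ Q)) := by
  classical
  obtain ⟨V, hV, rfl⟩ := hP
  obtain ⟨W, hW, rfl⟩ := hQ
  refine ⟨V ∪ W, hV.mono (by simp), ?_⟩
  rw [convexHull_convexHull_union_left, convexHull_convexHull_union_right, Finset.coe_union,
    Set.image_union]

theorem latt_of_InP {n : ℕ} (k : ℕ) : ∀ (P : Set (Fin n → ℝ)), InPclass k P → IsLatticePolytope P := by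
  induction k with
  | zero => rintro P ⟨v, rfl⟩; exact latt_pt v
  | succ k ih =>
    rintro P ⟨l, Q, -, hQ, rfl⟩
    refine Finset.sum_induction Q IsLatticePolytope latt_add ?_ ?_
    · have := latt_pt (0 : Fin n → ℤ)
      convert this using 1
      ext x; simp [funext_iff]
    intro i _
    obtain ⟨Q₁, Q₂, h1, h2, e⟩ := hQ i
    rw [e]
    exact latt_hull _ _ (ih _ h1) (ih _ h2)

theorem dotR_add {n : ℕ} (c x y : Fin n → ℝ) : dotR c (x + y) = dotR c x + dotR c y := by
  simp [dotR, mul_add, Finset.sum_add_distrib]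

theorem dotR_smul {n : ℕ} (c x : Fin n → ℝ) (t : ℝ) : dotR c (t • x) = t * dotR c x := by
  simp only [dotR, Finset.mul_sum, Pi.smul_apply, smul_eq_mul]
  exact Finset.sum_congr rfl fun i _ => by ring

def argminHom {n : ℕ} (c : Fin n → ℝ) : Set (Fin n → ℝ) →+ Set (Fin n → ℝ) where
  toFun := argminSet c
  map_zero' := by
    ext x
    simp only [argminSet, Set.mem_zero, Set.mem_ofPred_eq]
    constructor
    · exact fun h => h.1
    · rintro rfl
      exact ⟨rfl, fun y hy => by rw [hy]⟩
  map_add' A B := by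
    ext x
    constructor
    · rintro ⟨⟨a, ha, b, hb, rfl⟩, h⟩
      refine ⟨a, ⟨ha, fun y hy => ?_⟩, b, ⟨hb, fun y hy => ?_⟩, rfl⟩
      · have := h _ (Set.add_mem_add hy hb)
        simp only [dotR_add] at this; linarith
      · have := h _ (Set.add_mem_add ha hy)
        simp only [dotR_add] at this; linarith
    · rintro ⟨a, ⟨ha, ha'⟩, b, ⟨hb, hb'⟩, rfl⟩
      refine ⟨Set.add_mem_add ha hb, ?_⟩
      rintro _ ⟨a', h1, b', h2, rfl⟩
      simp only [dotR_add]
      exact add_le_add (ha' _ h1) (hb' _ h2)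

theorem argmin_convex {n : ℕ} (c : Fin n → ℝ) {A : Set (Fin n → ℝ)} (hA : Convex ℝ A) :
    Convex ℝ (argminSet c A) := by
  rintro x ⟨hx, hx'⟩ y ⟨hy, hy'⟩ a b ha hb hab
  refine ⟨hA hx hy ha hb hab, fun z hz => ?_⟩
  rw [dotR_add, dotR_smul, dotR_smul]
  have := hx' z hz
  have := hy' z hz
  have e : dotR c z = a * dotR c z + b * dotR c z := by rw [← add_mul, hab, one_mul]
  rw [e]
  gcongr

theorem argmin_lt {n : ℕ} (c : Fin n → ℝ) {A B : Set (Fin n → ℝ)} (hA : Convex ℝ A)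
    (hB : Convex ℝ B) {a b : Fin n → ℝ} (ha : a ∈ argminSet c A) (hb : b ∈ argminSet c B)
    (h : dotR c a < dotR c b) :
    argminSet c (convexHull ℝ (A ∪ B)) = convexHull ℝ (argminSet c A ∪ argminSet c A) := by
  rw [Set.union_self, (argmin_convex c hA).convexHull_eq]
  have hAm : A ⊆ convexHull ℝ (A ∪ B) := Set.subset_union_left.trans (subset_convexHull ℝ _)
  ext x
  constructor
  · rintro ⟨hx, hx'⟩
    have h1 := hx' a (hAm ha.1)
    obtain ⟨s, h0, hs1, p, hp, q, hq, rfl⟩ := (mem_hull_union hA hB ⟨a, ha.1⟩ ⟨b, hb.1⟩).1 hx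
    rw [dotR_add, dotR_smul, dotR_smul] at h1
    have h2 := ha.2 p hp
    have h3 := hb.2 q hq
    have hs : s = 0 := by
      by_contra hs
      have : 0 < s := lt_of_le_of_ne h0 (Ne.symm hs)
      nlinarith
    subst hs
    simp only [sub_zero, one_smul, zero_smul, add_zero] at hx' ⊢
    exact ⟨hp, fun y hy => hx' y (hAm hy)⟩
  · rintro ⟨hx, hx'⟩
    refine ⟨hAm hx, fun y hy => ?_⟩
    obtain ⟨s, h0, hs1, p, hp, q, hq, rfl⟩ := (mem_hull_union hA hB ⟨a, ha.1⟩ ⟨b, hb.1⟩).1 hy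
    rw [dotR_add, dotR_smul, dotR_smul]
    have h2 := hx' p hp
    have h3 := hb.2 q hq
    have h4 := hx' a ha.1
    nlinarith

theorem argmin_eq {n : ℕ} (c : Fin n → ℝ) {A B : Set (Fin n → ℝ)} (hA : Convex ℝ A)
    (hB : Convex ℝ B) {a b : Fin n → ℝ} (ha : a ∈ argminSet c A) (hb : b ∈ argminSet c B)
    (h : dotR c a = dotR c b) :
    argminSet c (convexHull ℝ (A ∪ B)) = convexHull ℝ (argminSet c A ∪ argminSet c B) := by
  have hAm : A ⊆ convexHull ℝ (A ∪ B) := Set.subset_union_left.trans (subset_convexHull ℝ _)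
  have key : ∀ y ∈ convexHull ℝ (A ∪ B), dotR c a ≤ dotR c y := by
    intro y hy
    obtain ⟨s, h0, hs1, p, hp, q, hq, rfl⟩ := (mem_hull_union hA hB ⟨a, ha.1⟩ ⟨b, hb.1⟩).1 hy
    rw [dotR_add, dotR_smul, dotR_smul]
    have h2 := ha.2 p hp
    have h3 := hb.2 q hq
    nlinarith
  apply subset_antisymm
  · rintro x ⟨hx, hx'⟩
    have h1 := hx' a (hAm ha.1)
    obtain ⟨s, h0, hs1, p, hp, q, hq, rfl⟩ := (mem_hull_union hA hB ⟨a, ha.1⟩ ⟨b, hb.1⟩).1 hx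
    rw [dotR_add, dotR_smul, dotR_smul] at h1
    have h2 := ha.2 p hp
    have h3 := hb.2 q hq
    rw [mem_hull_union (argmin_convex c hA) (argmin_convex c hB) ⟨a, ha⟩ ⟨b, hb⟩]
    rcases eq_or_lt_of_le h0 with rfl | h0'
    · refine ⟨0, le_rfl, zero_le_one, p, ⟨hp, fun y hy => ?_⟩, b, hb, by simp⟩
      have := ha.2 y hy
      linarith
    rcases eq_or_lt_of_le hs1 with rfl | hs1'
    · refine ⟨1, zero_le_one, le_rfl, a, ha, q, ⟨hq, fun y hy => ?_⟩, by simp⟩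
      have := hb.2 y hy
      linarith
    refine ⟨s, h0, hs1, p, ⟨hp, fun y hy => ?_⟩, q, ⟨hq, fun y hy => ?_⟩, rfl⟩
    · have := ha.2 y hy
      nlinarith
    · have := hb.2 y hy
      nlinarith
  · refine convexHull_min (Set.union_subset ?_ ?_) (argmin_convex c (convex_convexHull _ _))
    · rintro x ⟨hx, hx'⟩
      exact ⟨hAm hx, fun y hy => (hx' a ha.1).trans (key y hy)⟩
    · rintro x ⟨hx, hx'⟩
      exact ⟨subset_convexHull _ _ (Or.inr hx), fun y hy =>
        ((hx' b hb.1).trans h.ge).trans (key y hy)⟩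

theorem argmin_nonempty {n : ℕ} (c : Fin n → ℝ) {P : Set (Fin n → ℝ)} (hL : IsLatticePolytope P) :
    (argminSet c P).Nonempty := by
  obtain ⟨V, hV, hPV⟩ := hL
  have hPc : IsCompact P := by
    rw [hPV]; exact ((V.finite_toSet).image _).isCompact_convexHull ℝ
  have hne : P.Nonempty := by
    rw [hPV]; exact (Set.Nonempty.image _ (by simpa using hV)).convexHull
  obtain ⟨x, hx, h⟩ := hPc.exists_isMinOn (f := dotR c) hne (by unfold dotR; fun_prop)
  exact ⟨x, hx, fun y hy => h hy⟩

theorem face_InP {n : ℕ} (c : Fin n → ℝ) (k : ℕ) :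
    ∀ (P : Set (Fin n → ℝ)), InPclass k P → InPclass k (argminSet c P) := by
  induction k with
  | zero =>
    rintro P ⟨v, rfl⟩
    refine ⟨v, ?_⟩
    ext x
    constructor
    · exact fun h => h.1
    · rintro rfl
      exact ⟨rfl, fun y hy => by rw [hy]⟩
  | succ k ih =>
    rintro P ⟨l, Q, hl, hQ, rfl⟩
    refine ⟨l, fun i => argminSet c (Q i), hl, fun i => ?_, map_sum (argminHom c) Q _⟩
    obtain ⟨A, B, hA, hB, e⟩ := hQ i
    obtain ⟨a, ha⟩ := argmin_nonempty c (latt_of_InP k A hA)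
    obtain ⟨b, hb⟩ := argmin_nonempty c (latt_of_InP k B hB)
    have cA := (good_of_InP k A hA).1.1
    have cB := (good_of_InP k B hB).1.1
    dsimp only
    rw [e]
    rcases lt_trichotomy (dotR c a) (dotR c b) with h | h | h
    · exact ⟨_, _, ih A hA, ih A hA, argmin_lt c cA cB ha hb h⟩
    · exact ⟨_, _, ih A hA, ih B hB, argmin_eq c cA cB ha hb h⟩
    · rw [Set.union_comm]
      exact ⟨_, _, ih B hB, ih B hB, argmin_lt c cB cA hb ha h⟩

/-- `P_k ⊆ Q_k`: every face of dimension at least `2^k` of a polytope in `P_k` has even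
normalized volume. -/
theorem Pk_subset_Qk {n : ℕ} (k : ℕ) (P : Set (Fin n → ℝ)) (hP : InPclass k P) :
    InQclass k P := by
  refine ⟨latt_of_InP k P hP, ?_⟩
  rintro F (rfl | ⟨c, rfl⟩) hd
  · exfalso
    have : 0 < 2 ^ k := by positivity
    rw [polyDim, AffineSubspace.span_empty, AffineSubspace.direction_bot, finrank_bot] at hd
    omega
  · have h := face_InP c k P hP
    exact evenVol_of_good k _ (good_of_InP k _ h) (latt_of_InP k _ h) hd

end
end

section
/- If a ReLU neural network (with affine layer maps T^(ℓ)(x) = A^(ℓ)x + b^(ℓ)) represents a positively homogeneous function f, then the network obtained by setting all bias vectors b^(ℓ) to zero represents exactly the same function f. -/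
open Pointwise MeasureTheory

noncomputable section

/-- A feedforward ReLU network with real weights: a final affine layer, or an affine layer
followed by the componentwise rectifier and the rest of the network. -/
inductive Net : ℕ → ℕ → Type where
  | last {n m : ℕ} (A : Matrix (Fin m) (Fin n) ℝ) (b : Fin m → ℝ) : Net n m
  | cons {n p m : ℕ} (A : Matrix (Fin p) (Fin n) ℝ) (b : Fin p → ℝ) (N : Net p m) : Net n m

/-- The function computed by a ReLU network. -/
def Net.eval : {n m : ℕ} → Net n m → (Fin n → ℝ) → (Fin m → ℝ)
  | _, _, .last A b => fun x => A.mulVec x + b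
  | _, _, .cons A b N => fun x => N.eval fun i => max 0 (A.mulVec x i + b i)

/-- The same network with all bias vectors replaced by zero. -/
def Net.zeroBias : {n m : ℕ} → Net n m → Net n m
  | _, _, .last A _ => .last A 0
  | _, _, .cons A _ N => .cons A 0 N.zeroBias

/-- `f` is positively homogeneous: `f (λ • x) = λ • f x` for all `λ ≥ 0`. -/
def PosHom {n m : ℕ} (f : (Fin n → ℝ) → (Fin m → ℝ)) : Prop :=
  ∀ l : ℝ, 0 ≤ l → ∀ x, f (l • x) = l • f x

open Filter Topology in
lemma Net.tendsto_scaled {n m : ℕ} (N : Net n m) : ∀ (u : ℝ → Fin n → ℝ) (y : Fin n → ℝ),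
    Tendsto (fun t : ℝ => t • u t) (𝓝[>] 0) (𝓝 y) →
    Tendsto (fun t : ℝ => t • N.eval (u t)) (𝓝[>] 0) (𝓝 (N.zeroBias.eval y)) := by
  have key : ∀ {n m : ℕ} (A : Matrix (Fin m) (Fin n) ℝ) (b : Fin m → ℝ)
      (u : ℝ → Fin n → ℝ) (y : Fin n → ℝ),
      Tendsto (fun t : ℝ => t • u t) (𝓝[>] 0) (𝓝 y) →
      Tendsto (fun t : ℝ => t • (A.mulVec (u t) + b)) (𝓝[>] 0) (𝓝 (A.mulVec y + 0)) := by
    intro n m A b u y h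
    have hA : Continuous fun v : Fin n → ℝ => A.mulVec v :=
      Continuous.matrix_mulVec continuous_const continuous_id
    have h1 := (hA.tendsto y).comp h
    have h2 : Tendsto (fun t : ℝ => t • b) (𝓝[>] 0) (𝓝 0) := by
      have : Continuous fun t : ℝ => t • b := by fun_prop
      have h3 := this.tendsto 0
      rw [zero_smul] at h3
      exact h3.mono_left nhdsWithin_le_nhds
    refine (h1.add h2).congr fun t => ?_
    simp [Matrix.mulVec_smul, smul_add]
  induction N with
  | last A b =>
    intro u y h
    exact key A b u y h
  | cons A b N ih =>
    intro u y h
    refine ih (fun t i => max 0 (A.mulVec (u t) i + b i)) _ ?_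
    have h1 := key A b u y h
    rw [tendsto_pi_nhds] at h1 ⊢
    intro i
    refine ((tendsto_const_nhds (x := (0 : ℝ))).max (h1 i)).congr' ?_
    filter_upwards [self_mem_nhdsWithin] with t ht
    have ht' : (0 : ℝ) ≤ t := le_of_lt ht
    simp [mul_max_of_nonneg _ _ ht']

/-- If a ReLU network represents a positively homogeneous function, then the same network
with all biases set to zero represents exactly the same function. -/
theorem zeroBias_eval_eq_of_posHom {n m : ℕ} (N : Net n m) (f : (Fin n → ℝ) → (Fin m → ℝ))
    (hrep : ∀ x, N.eval x = f x) (hpos : PosHom f) :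
    ∀ x, N.zeroBias.eval x = f x := by
  intro x
  have hx : ∀ (g : (Fin n → ℝ)), ∀ t : ℝ, 0 < t → t • t⁻¹ • g = g := by
    intro g t ht
    rw [smul_smul, mul_inv_cancel₀ ht.ne', one_smul]
  have h := N.tendsto_scaled (fun t => t⁻¹ • x) x (by
    refine tendsto_const_nhds.congr' ?_
    filter_upwards [self_mem_nhdsWithin] with t ht
    exact (hx x t ht).symm)
  refine tendsto_nhds_unique h (tendsto_const_nhds.congr' ?_)
  filter_upwards [self_mem_nhdsWithin] with t ht
  have ht' : (0 : ℝ) < t := ht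
  rw [hrep, ← hpos t ht'.le, hx x t ht]

end
end

section
/- For every k ≥ 1 and n ≥ 2^{k-1}, the function f : R^n → R given by f(x) = max{0, x_1, ..., x_{2^{k-1}}} can be represented by a ReLU neural network with k hidden layers in which all weights and biases are integers; that is, f ∈ ReLU^Z_n(k). -/
open Pointwise MeasureTheory

noncomputable section

/-- `IntReLUrep k n m f`: the function `f : ℝ^n → ℝ^m` is computed by a feedforward ReLU
neural network with `k` hidden layers in which all weights and biases are integers. -/
def IntReLUrep : ℕ → (n : ℕ) → (m : ℕ) → ((Fin n → ℝ) → (Fin m → ℝ)) → Prop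
  | 0, n, m, f => ∃ (A : Matrix (Fin m) (Fin n) ℤ) (b : Fin m → ℤ),
      ∀ x, f x = fun i => (∑ j, (A i j : ℝ) * x j) + (b i : ℝ)
  | k+1, n, m, f => ∃ (p : ℕ) (A : Matrix (Fin p) (Fin n) ℤ) (b : Fin p → ℤ)
      (g : (Fin p → ℝ) → (Fin m → ℝ)), IntReLUrep k p m g ∧
      ∀ x, f x = g (fun i => max 0 ((∑ j, (A i j : ℝ) * x j) + (b i : ℝ)))

/-- `ReLU^ℤ_n(k)`: real-valued functions on `ℝ^n` computable by an integral ReLU network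
with `k` hidden layers. -/
def IntReLU (n k : ℕ) (f : (Fin n → ℝ) → ℝ) : Prop :=
  ∃ F : (Fin n → ℝ) → (Fin 1 → ℝ), IntReLUrep k n 1 F ∧ ∀ x, f x = F x 0

/-- `maxZero x = max {0, x 1, …, x n}`. -/
def maxZero {n : ℕ} (x : Fin n → ℝ) : ℝ := Finset.univ.fold max 0 x

theorem maxZero_le_iff {n : ℕ} (x : Fin n → ℝ) (c : ℝ) :
    maxZero x ≤ c ↔ 0 ≤ c ∧ ∀ i, x i ≤ c := by
  simp [maxZero, Finset.fold_max_le]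

theorem maxZero_pair {a b : ℕ} (h : b = a + a) (y : Fin b → ℝ) :
    maxZero y = maxZero (fun i : Fin a =>
      max (y ⟨i, by omega⟩) (y ⟨a + i, by omega⟩)) := by
  refine eq_of_forall_ge_iff fun c => ?_
  rw [maxZero_le_iff, maxZero_le_iff]
  refine and_congr_right fun _ => ⟨fun H i => max_le (H _) (H _), fun H i => ?_⟩
  by_cases hi : (i : ℕ) < a
  · exact (le_max_left _ _).trans (H ⟨i, hi⟩)
  · have h1 := (le_max_right _ _).trans (H ⟨i - a, by omega⟩)
    have h2 : (⟨a + (i - a), by omega⟩ : Fin b) = i := Fin.ext (by simp; omega)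
    simpa only [h2] using h1

theorem max_relu (s t : ℝ) : max s t = max 0 (s - t) + max 0 t - max 0 (-t) := by
  rcases le_total s t with h | h <;> rcases le_total 0 t with h' | h' <;>
    simp [max_def] <;> split_ifs <;> linarith

theorem rep_max (k : ℕ) : ∀ (n : ℕ) (A : Matrix (Fin (2 ^ k)) (Fin n) ℤ),
    IntReLUrep (k + 1) n 1 (fun x _ => maxZero (fun i => ∑ j, (A i j : ℝ) * x j)) := by
  induction k with
  | zero =>
    intro n A
    refine ⟨1, fun _ j => A 0 j, 0, fun z => z, ⟨1, 0, fun x => ?_⟩, fun x => ?_⟩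
    · funext i
      simp [Matrix.one_apply]
      intro h
      exact absurd (Subsingleton.elim i 0) h
    · funext i
      refine eq_of_forall_ge_iff fun c => ?_
      rw [maxZero_le_iff, max_le_iff]
      refine and_congr_right fun _ => ⟨fun H => by simpa using H 0, fun H i => ?_⟩
      have : i = 0 := Fin.ext (by have := i.2; simp at this ⊢)
      subst this
      simpa using H
  | succ k ih =>
    intro n A
    have hb : 2 ^ (k + 1) = 2 ^ k + 2 ^ k := by ring
    let u : Fin (2 ^ k) → Fin (2 ^ (k + 1)) := fun i => ⟨i, by omega⟩
    let v : Fin (2 ^ k) → Fin (2 ^ (k + 1)) := fun i => ⟨2 ^ k + i, by omega⟩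
    let e := finProdFinEquiv (m := 2 ^ k) (n := 3)
    refine ⟨2 ^ k * 3,
      fun q j => ![A (u (e.symm q).1) j - A (v (e.symm q).1) j, A (v (e.symm q).1) j,
        - A (v (e.symm q).1) j] (e.symm q).2, 0, _,
      ih (2 ^ k * 3) (fun i q => if i = (e.symm q).1 then ![1, 1, -1] (e.symm q).2 else 0),
      fun x => ?_⟩
    funext _
    refine (maxZero_pair hb _).trans ?_
    congr 1
    funext i
    rw [← e.sum_comp, Fintype.sum_prod_type]
    rw [Finset.sum_eq_single i]
    · simp only [Equiv.symm_apply_apply, Fin.sum_univ_three]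
      rw [max_relu]
      simp [u, v, sub_mul, Finset.sum_sub_distrib]
      ring
    · intro i' _ hi'
      simp [hi'.symm]
    · simp

/-- For `k ≥ 1` and `n ≥ 2^{k-1}`, the function `max {0, x_1, …, x_{2^{k-1}}}` on `ℝ^n`
is computable by an integral ReLU network with `k` hidden layers. -/
theorem max_in_IntReLU (k n : ℕ) (hk : 1 ≤ k) (hn : 2 ^ (k - 1) ≤ n) :
    IntReLU n k (fun x => maxZero (fun i : Fin (2 ^ (k - 1)) => x (Fin.castLE hn i))) := by
  obtain ⟨k, rfl⟩ : ∃ l, k = l + 1 := ⟨k - 1, by omega⟩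
  refine ⟨_, rep_max k n (fun i j => if j = Fin.castLE hn i then 1 else 0), fun x => ?_⟩
  simp

end
end

section
/- Let P ⊂ R^n be a lattice polytope in the class Q_k with n = 2^k. In the subdivision of P + Δ^n_0 into affine products of faces of P and faces of Δ^n_0 obtained by a generic lifting, there is exactly one full-dimensional cell that is an affine product of a 0-dimensional face of P and a 2^k-dimensional face of Δ^n_0; this cell is a translate of Δ^n_0 and has normalized volume 1, while every other full-dimensional cell has even normalized volume. -/
open Pointwise MeasureTheory

noncomputable section

section

def dotL {n : ℕ} (c : Fin n → ℝ) : (Fin n → ℝ) →ₗ[ℝ] ℝ := ∑ i, c i • LinearMap.proj i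

theorem dotL_apply {n : ℕ} (c x : Fin n → ℝ) : dotL c x = dotR c x := by
  simp [dotL, dotR]

theorem dotR_add_left {n : ℕ} (c d x : Fin n → ℝ) : dotR (c + d) x = dotR c x + dotR d x := by
  simp [dotR, add_mul, Finset.sum_add_distrib]

theorem dotR_sub_left {n : ℕ} (c d x : Fin n → ℝ) : dotR (c - d) x = dotR c x - dotR d x := by
  simp [dotR, sub_mul, Finset.sum_sub_distrib]

theorem dotR_single {n : ℕ} (c : Fin n → ℝ) (i : Fin n) : dotR c (Pi.single i 1) = c i := by
  simp [dotR, Pi.single_apply]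

theorem dotR_eq_zero {n : ℕ} (c : Fin n → ℝ) (h : ∀ x, dotR c x = 0) : c = 0 := by
  funext i
  rw [← dotR_single c i, h]; rfl

theorem exists_dotR_of_linear {n : ℕ} (f : (Fin n → ℝ) →ₗ[ℝ] ℝ) : ∃ c, ∀ x, f x = dotR c x := by
  refine ⟨fun i => f (Pi.single i 1), fun x => ?_⟩
  rw [LinearMap.pi_apply_eq_sum_univ f x]
  simp only [dotR, smul_eq_mul]
  refine Finset.sum_congr rfl fun i _ => ?_
  rw [mul_comm]
  congr 2
  funext j
  simp [Pi.single_apply, eq_comm]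

theorem hull_min_face {E : Type*} [AddCommGroup E] [Module ℝ E] (s : Set E) (f : E →ₗ[ℝ] ℝ)
    (m : ℝ) (hm : ∀ y ∈ s, m ≤ f y) (x : E) :
    x ∈ convexHull ℝ {y ∈ s | f y = m} ↔ x ∈ convexHull ℝ s ∧ f x = m := by
  constructor
  · intro hx
    refine ⟨convexHull_mono (fun y hy => hy.1) hx, ?_⟩
    have hc : Convex ℝ {y | f y = m} := convex_hyperplane f.isLinear m
    exact convexHull_min (fun y hy => hy.2) hc hx
  · rintro ⟨hx, hfx⟩
    obtain ⟨κ, _, w, z, hw0, hw1, hz, rfl⟩ := mem_convexHull_iff_exists_fintype.1 hx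
    have h0 : ∑ i, w i * (f (z i) - m) = 0 := by
      simp only [mul_sub, Finset.sum_sub_distrib, ← Finset.sum_mul, hw1]
      rw [map_sum] at hfx
      simp only [map_smul, smul_eq_mul] at hfx
      rw [hfx]; ring
    have h1 := (Finset.sum_eq_zero_iff_of_nonneg (fun i _ =>
      mul_nonneg (hw0 i) (sub_nonneg.2 (hm _ (hz i))))).1 h0
    classical
    have h2 : ∀ i, f (z i) ≠ m → w i = 0 := fun i hi => by
      have := h1 i (Finset.mem_univ i)
      rcases mul_eq_zero.1 this with h | h
      · exact h
      · exact absurd (sub_eq_zero.1 h) hi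
    have e1 : ∑ i, w i • z i = ∑ i ∈ Finset.univ.filter (fun i => f (z i) = m), w i • z i := by
      rw [Finset.sum_filter_of_ne]
      intro i _ hi
      by_contra hne
      exact hi (by rw [h2 i hne, zero_smul])
    have e2 : ∑ i, w i = ∑ i ∈ Finset.univ.filter (fun i => f (z i) = m), w i := by
      rw [Finset.sum_filter_of_ne]
      intro i _ hi
      by_contra hne
      exact hi (h2 i hne)
    rw [e1]
    refine (convex_convexHull ℝ _).sum_mem (fun i _ => hw0 i) (e2 ▸ hw1) fun i hi => ?_
    exact subset_convexHull ℝ _ ⟨hz i, (Finset.mem_filter.1 hi).2⟩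

set_option linter.unusedSectionVars false
section cells
variable {n : ℕ} {ι : Type*}

def lact (a : ι → Fin n → ℝ) (h : ι → ℝ) (c : Fin n → ℝ) : Set ι :=
  {j | ∀ l, h j + dotR c (a j) ≤ h l + dotR c (a l)}

def lcell (a : ι → Fin n → ℝ) (h : ι → ℝ) (c : Fin n → ℝ) : Set (Fin n → ℝ) :=
  convexHull ℝ (a '' lact a h c)

def lmin (a : ι → Fin n → ℝ) (h : ι → ℝ) (c : Fin n → ℝ) : ℝ :=
  ⨅ j, (h j + dotR c (a j))

def liftHull (a : ι → Fin n → ℝ) (h : ι → ℝ) : Set ((Fin n → ℝ) × ℝ) :=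
  convexHull ℝ (Set.range fun j => (a j, h j))

def liftF (c : Fin n → ℝ) : ((Fin n → ℝ) × ℝ) →ₗ[ℝ] ℝ :=
  LinearMap.snd ℝ _ _ + (dotL c).comp (LinearMap.fst ℝ _ _)

theorem liftF_apply (c : Fin n → ℝ) (x : (Fin n → ℝ) × ℝ) : liftF c x = x.2 + dotR c x.1 := by
  simp [liftF, dotL_apply]

variable [Finite ι] [Nonempty ι] (a : ι → Fin n → ℝ) (h : ι → ℝ)

theorem lmin_le (c : Fin n → ℝ) (j : ι) : lmin a h c ≤ h j + dotR c (a j) :=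
  ciInf_le (Set.finite_range _).bddBelow j

theorem mem_lact_iff (c : Fin n → ℝ) (j : ι) :
    j ∈ lact a h c ↔ h j + dotR c (a j) = lmin a h c := by
  constructor
  · intro hj
    exact le_antisymm (le_ciInf hj) (lmin_le a h c j)
  · intro hj l
    rw [hj]; exact lmin_le a h c l

theorem lact_nonempty (c : Fin n → ℝ) : (lact a h c).Nonempty := by
  obtain ⟨j, hj⟩ := exists_eq_ciInf_of_finite (f := fun j => h j + dotR c (a j))
  exact ⟨j, (mem_lact_iff a h c j).2 hj⟩

theorem lcell_nonempty (c : Fin n → ℝ) : (lcell a h c).Nonempty :=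
  ((lact_nonempty a h c).image a).convexHull

theorem mem_lcell_iff (c x : Fin n → ℝ) :
    x ∈ lcell a h c ↔ ∃ t, (x, t) ∈ liftHull a h ∧ t + dotR c x = lmin a h c := by
  have key := hull_min_face (Set.range fun j => (a j, h j)) (liftF c) (lmin a h c) (by
    rintro _ ⟨j, rfl⟩
    rw [liftF_apply]; exact lmin_le a h c j)
  have e : lcell a h c = (LinearMap.fst ℝ (Fin n → ℝ) ℝ) '' (convexHull ℝ
      {y ∈ Set.range fun j => (a j, h j) | liftF c y = lmin a h c}) := by
    rw [LinearMap.image_convexHull, lcell]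
    congr 1
    ext y
    constructor
    · rintro ⟨j, hj, rfl⟩
      exact ⟨(a j, h j), ⟨⟨j, rfl⟩, by rw [liftF_apply]; exact (mem_lact_iff a h c j).1 hj⟩, rfl⟩
    · rintro ⟨_, ⟨⟨j, rfl⟩, hj⟩, rfl⟩
      rw [liftF_apply] at hj
      exact ⟨j, (mem_lact_iff a h c j).2 hj, rfl⟩
  rw [e]
  constructor
  · rintro ⟨⟨y, t⟩, hy, rfl⟩
    have := (key _).1 hy
    rw [liftF_apply] at this
    exact ⟨t, this⟩
  · rintro ⟨t, ht⟩
    exact ⟨(x, t), (key _).2 (by rw [liftF_apply]; exact ht), rfl⟩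

theorem lmin_le_lift (c x : Fin n → ℝ) (t : ℝ) (hx : (x, t) ∈ liftHull a h) :
    lmin a h c ≤ t + dotR c x := by
  have hc : Convex ℝ {y | lmin a h c ≤ liftF c y} := convex_halfSpace_ge (liftF c).isLinear _
  have := convexHull_min (s := Set.range fun j => (a j, h j)) (by
    rintro _ ⟨j, rfl⟩
    show _ ≤ liftF c _
    rw [liftF_apply]; exact lmin_le a h c j) hc hx
  simpa [liftF_apply] using this

theorem lcell_ge (c c' x : Fin n → ℝ) (hx : x ∈ lcell a h c) :
    lmin a h c' - lmin a h c ≤ dotR (c' - c) x := by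
  obtain ⟨t, ht, he⟩ := (mem_lcell_iff a h c x).1 hx
  have := lmin_le_lift a h c' x t ht
  rw [dotR_sub_left]; linarith

theorem lcell_inter_iff (c c' x : Fin n → ℝ) (hx : x ∈ lcell a h c) :
    x ∈ lcell a h c' ↔ dotR (c' - c) x = lmin a h c' - lmin a h c := by
  obtain ⟨t, ht, he⟩ := (mem_lcell_iff a h c x).1 hx
  rw [dotR_sub_left]
  constructor
  · intro hx'
    obtain ⟨t', ht', he'⟩ := (mem_lcell_iff a h c' x).1 hx'
    have h1 := lmin_le_lift a h c' x t ht
    have h2 := lmin_le_lift a h c x t' ht'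
    linarith
  · intro h1
    exact (mem_lcell_iff a h c' x).2 ⟨t, ht, by linarith⟩

theorem lcell_face (c c' : Fin n → ℝ) :
    IsFace (lcell a h c) (lcell a h c ∩ lcell a h c') := by
  rcases Set.eq_empty_or_nonempty (lcell a h c ∩ lcell a h c') with he | ⟨y, hy, hy'⟩
  · exact Or.inl he
  · right
    refine ⟨c' - c, ?_⟩
    have ey := (lcell_inter_iff a h c c' y hy).1 hy'
    ext x
    constructor
    · rintro ⟨hx, hx'⟩
      refine ⟨hx, fun z hz => ?_⟩
      rw [(lcell_inter_iff a h c c' x hx).1 hx']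
      exact lcell_ge a h c c' z hz
    · rintro ⟨hx, hx'⟩
      refine ⟨hx, (lcell_inter_iff a h c c' x hx).2 (le_antisymm ?_ (lcell_ge a h c c' x hx))⟩
      rw [← ey]; exact hx' y hy

theorem lcell_compact (c : Fin n → ℝ) : IsCompact (lcell a h c) :=
  ((Set.toFinite _).image a).isCompact_convexHull ℝ

theorem lcell_polytope (c : Fin n → ℝ) : IsPolytope (lcell a h c) := by
  classical
  have hf : (a '' lact a h c).Finite := (Set.toFinite _).image a
  refine ⟨hf.toFinset, ?_, by simp [lcell]⟩
  simpa using (lact_nonempty a h c)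

theorem lcell_range_finite : (Set.range (lcell a h)).Finite := by
  have : Set.range (lcell a h) ⊆ Set.range (fun s : Set ι => convexHull ℝ (a '' s)) := by
    rintro _ ⟨c, rfl⟩
    exact ⟨lact a h c, rfl⟩
  exact (Set.finite_range _).subset this

theorem lcell_subset (c : Fin n → ℝ) : lcell a h c ⊆ convexHull ℝ (Set.range a) :=
  convexHull_mono (Set.image_subset_range _ _)

theorem lift_exists (x : Fin n → ℝ) (hx : x ∈ convexHull ℝ (Set.range a)) :
    ∃ t, (x, t) ∈ liftHull a h := by
  have : (LinearMap.fst ℝ (Fin n → ℝ) ℝ) '' (liftHull a h) = convexHull ℝ (Set.range a) := by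
    rw [liftHull, LinearMap.image_convexHull, ← Set.range_comp]; rfl
  rw [← this] at hx
  obtain ⟨⟨y, t⟩, hy, rfl⟩ := hx
  exact ⟨t, hy⟩

theorem cover_interior (x : Fin n → ℝ) (hx : x ∈ interior (convexHull ℝ (Set.range a))) :
    ∃ c, x ∈ lcell a h c := by
  have hcomp : IsCompact (liftHull a h) := (Set.finite_range _).isCompact_convexHull ℝ
  -- minimal height
  obtain ⟨t0, ht0, hmin⟩ : ∃ t0, (x, t0) ∈ liftHull a h ∧ ∀ t, (x, t) ∈ liftHull a h → t0 ≤ t := by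
    have hK : IsCompact (liftHull a h ∩ {p | p.1 = x}) :=
      hcomp.inter_right (isClosed_eq continuous_fst continuous_const)
    obtain ⟨t, ht⟩ := lift_exists a h x (interior_subset hx)
    obtain ⟨⟨y, s⟩, ⟨hy, rfl⟩, hmin⟩ := hK.exists_isMinOn ⟨(x, t), ht, rfl⟩
      (continuous_snd.continuousOn)
    exact ⟨s, hy, fun t ht => hmin ⟨ht, rfl⟩⟩
  obtain ⟨T, hT⟩ : ∃ T, ∀ p ∈ liftHull a h, p.2 ≤ T := by
    obtain ⟨T, hT⟩ := (hcomp.image continuous_snd).bddAbove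
    exact ⟨T, fun p hp => hT ⟨p, hp, rfl⟩⟩
  let A : Set ((Fin n → ℝ) × ℝ) := {p | ∃ s ≤ p.2, (p.1, s) ∈ liftHull a h}
  have hA : Convex ℝ A := by
    rintro ⟨y, r⟩ ⟨s, hs, hy⟩ ⟨y', r'⟩ ⟨s', hs', hy'⟩ α β hα hβ hαβ
    refine ⟨α * s + β * s', ?_, ?_⟩
    · simp only [Prod.snd_add, Prod.smul_snd, smul_eq_mul] at *
      gcongr
    · exact (convex_convexHull ℝ _) hy hy' hα hβ hαβ
  have hint : (interior A).Nonempty := by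
    refine ⟨(x, T + 1), ?_⟩
    refine mem_interior.2 ⟨interior (convexHull ℝ (Set.range a)) ×ˢ Set.Ioi T, ?_,
      isOpen_interior.prod isOpen_Ioi, hx, by simp⟩
    rintro ⟨y, r⟩ ⟨hy, hr⟩
    obtain ⟨s, hs⟩ := lift_exists a h y (interior_subset hy)
    exact ⟨s, (hT _ hs).trans (le_of_lt hr), hs⟩
  have hxA : (x, t0) ∉ interior A := by
    intro hmem
    have hcont : ContinuousAt (fun ε : ℝ => (x, t0 - ε)) 0 := by fun_prop
    have := hcont.preimage_mem_nhds (t := A) (by simpa using mem_interior_iff_mem_nhds.1 hmem)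
    obtain ⟨ε, hε, hb⟩ := Metric.mem_nhds_iff.1 this
    have : ε / 2 ∈ Metric.ball (0 : ℝ) ε := by
      simp [abs_of_pos hε]; linarith
    obtain ⟨s, hs, hs'⟩ := hb this
    have := hmin s hs'
    simp at hs
    linarith
  obtain ⟨f, hf0, hf⟩ := geometric_hahn_banach_of_nonempty_interior_point hA hxA hint
  obtain ⟨c, hc⟩ := exists_dotR_of_linear
    ((f : ((Fin n → ℝ) × ℝ) →ₗ[ℝ] ℝ).comp (LinearMap.inl ℝ (Fin n → ℝ) ℝ))
  have hc' : ∀ y t, f (y, t) = dotR c y + t * f (0, 1) := by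
    intro y t
    rw [← hc y]
    have : (y, t) = (y, (0:ℝ)) + t • ((0 : Fin n → ℝ), (1:ℝ)) := by simp
    rw [this, map_add, map_smul]; rfl
  set s := f (0, 1) with hs
  have hs0 : s ≤ 0 := by
    have := hf (x, t0 + 1) ⟨t0, by simp, ht0⟩
    rw [hc', hc'] at this
    nlinarith
  have hs1 : s < 0 := by
    refine lt_of_le_of_ne hs0 fun hs2 => hf0 ?_
    have hle : ∀ y ∈ convexHull ℝ (Set.range a), dotR c y ≤ dotR c x := by
      intro y hy
      obtain ⟨r, hr⟩ := lift_exists a h y hy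
      have := hf (y, r) ⟨r, le_rfl, hr⟩
      rw [hc', hc', hs2] at this
      simpa using this
    have hc0 : c = 0 := by
      have hcont : ContinuousAt (fun ε : ℝ => x + ε • c) 0 := by fun_prop
      have := hcont.preimage_mem_nhds (t := convexHull ℝ (Set.range a))
        (by simpa using mem_interior_iff_mem_nhds.1 hx)
      obtain ⟨ε, hε, hb⟩ := Metric.mem_nhds_iff.1 this
      have : ε / 2 ∈ Metric.ball (0 : ℝ) ε := by
        simp [abs_of_pos hε]; linarith
      have h3 := hle _ (hb this)
      rw [dotR_add, ← dotL_apply c ((ε/2) • c), map_smul, dotL_apply, smul_eq_mul] at h3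
      have h4 : dotR c c ≤ 0 := by nlinarith
      have h5 : ∑ i, c i * c i = 0 := le_antisymm h4 (Finset.sum_nonneg fun i _ => mul_self_nonneg _)
      funext i
      have := (Finset.sum_eq_zero_iff_of_nonneg (fun i _ => mul_self_nonneg (c i))).1 h5 i
        (Finset.mem_univ i)
      simpa using this
    refine ContinuousLinearMap.ext fun p => ?_
    obtain ⟨y, t⟩ := p
    rw [hc', hs2, hc0]
    simp [dotR]
  refine ⟨s⁻¹ • c, (mem_lcell_iff a h _ x).2 ⟨t0, ht0, ?_⟩⟩
  have hsc : ∀ y, dotR (s⁻¹ • c) y = s⁻¹ * dotR c y := by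
    intro y; simp [dotR, Finset.mul_sum, mul_assoc]
  refine le_antisymm ?_ (lmin_le_lift a h _ x t0 ht0)
  refine le_ciInf fun j => ?_
  have h1 := hf (a j, h j) ⟨h j, le_rfl, subset_convexHull ℝ _ ⟨j, rfl⟩⟩
  rw [hc', hc'] at h1
  rw [hsc, hsc]
  have h2 := mul_le_mul_of_nonpos_left h1 (inv_lt_zero.2 hs1).le
  have h3 : s⁻¹ * s = 1 := inv_mul_cancel₀ hs1.ne
  linear_combination h2 + (h j - t0) * h3

theorem cover_all (hne : (interior (convexHull ℝ (Set.range a))).Nonempty) :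
    (⋃ C ∈ Set.range (lcell a h), C) = convexHull ℝ (Set.range a) := by
  apply Set.Subset.antisymm
  · simp only [Set.iUnion_subset_iff]
    rintro _ ⟨c, rfl⟩
    exact lcell_subset a h c
  · have hcl : IsClosed (⋃ C ∈ Set.range (lcell a h), C) := by
      refine (lcell_range_finite a h).isClosed_biUnion ?_
      rintro _ ⟨c, rfl⟩
      exact (lcell_compact a h c).isClosed
    have h1 : interior (convexHull ℝ (Set.range a)) ⊆ (⋃ C ∈ Set.range (lcell a h), C) := by
      intro x hx
      obtain ⟨c, hc⟩ := cover_interior a h x hx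
      exact Set.mem_biUnion ⟨c, rfl⟩ hc
    have h2 := closure_minimal h1 hcl
    rw [(convex_convexHull ℝ _).closure_interior_eq_closure_of_nonempty_interior hne] at h2
    exact subset_closure.trans h2

theorem volume_cells (hne : (interior (convexHull ℝ (Set.range a))).Nonempty) :
    volume (convexHull ℝ (Set.range a)) =
      ∑ C ∈ (lcell_range_finite a h).toFinset, volume C := by
  rw [← cover_all a h hne]
  have := measure_biUnion_finset₀ (μ := (volume : Measure (Fin n → ℝ)))
    (s := (lcell_range_finite a h).toFinset) (f := id) ?_ ?_
  · simpa using this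
  · intro C hC D hD hCD
    simp only [Set.Finite.coe_toFinset] at hC hD
    obtain ⟨c, rfl⟩ := hC
    obtain ⟨c', rfl⟩ := hD
    have hcc : c' - c ≠ 0 := by
      intro h0
      exact hCD (by rw [sub_eq_zero.1 h0])
    let f := dotL (c' - c)
    show volume (lcell a h c ∩ lcell a h c') = 0
    rcases Set.eq_empty_or_nonempty (lcell a h c ∩ lcell a h c') with he | ⟨y, hy, hy'⟩
    · rw [he]; simp
    let S : AffineSubspace ℝ (Fin n → ℝ) := AffineSubspace.mk' y (LinearMap.ker f)
    have hS : S ≠ ⊤ := by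
      intro hS
      have : S.direction = ⊤ := by rw [hS]; simp
      rw [AffineSubspace.direction_mk', LinearMap.ker_eq_top] at this
      exact hcc (dotR_eq_zero _ fun x => by rw [← dotL_apply]; show f x = 0; rw [this]; rfl)
    refine measure_mono_null ?_ (Measure.addHaar_affineSubspace volume S hS)
    rintro x ⟨hx, hx'⟩
    show x ∈ S
    rw [AffineSubspace.mem_mk', LinearMap.mem_ker, vsub_eq_sub, map_sub]
    show dotL _ _ - dotL _ _ = 0
    rw [dotL_apply, dotL_apply, (lcell_inter_iff a h c c' x hx).1 hx',
      (lcell_inter_iff a h c c' y hy).1 hy', sub_self]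
  · intro C hC
    obtain ⟨c, rfl⟩ := (Set.Finite.mem_toFinset _).1 hC
    exact (lcell_compact a h c).isClosed.measurableSet.nullMeasurableSet

end cells

end

section

def sv (n : ℕ) : Option (Fin n) → Fin n → ℝ
  | none => 0
  | some i => Pi.single i 1

theorem std_eq_hull (n : ℕ) : stdSimplexPoly n = convexHull ℝ (Set.range (sv n)) := by
  unfold stdSimplexPoly
  congr 1
  ext x
  constructor
  · rintro (h | ⟨i, rfl⟩)
    · exact ⟨none, h.symm⟩
    · exact ⟨some i, by funext j; simp [sv, Pi.single_apply]⟩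
  · rintro ⟨_ | i, rfl⟩
    · exact Or.inl rfl
    · exact Or.inr ⟨i, by funext j; simp [sv, Pi.single_apply]⟩

def simp_set (n : ℕ) (t : ℝ) : Set (Fin n → ℝ) := {x | (∀ i, 0 ≤ x i) ∧ ∑ i, x i ≤ t}

theorem simp_set_meas (n : ℕ) (t : ℝ) : MeasurableSet (simp_set n t) := by
  have : simp_set n t = (⋂ i, {x | 0 ≤ x i}) ∩ {x | ∑ i, x i ≤ t} := by
    ext x; simp [simp_set]
  rw [this]
  refine (MeasurableSet.iInter fun i => ?_).inter ?_
  · exact measurableSet_le measurable_const (measurable_pi_apply i)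
  · exact measurableSet_le (by fun_prop) measurable_const

theorem std_eq_set (n : ℕ) : stdSimplexPoly n = simp_set n 1 := by
  rw [std_eq_hull]
  apply Set.Subset.antisymm
  · apply convexHull_min
    · rintro _ ⟨_ | i, rfl⟩
      · simp [sv, simp_set]
      · refine ⟨fun j => ?_, ?_⟩
        · simp only [sv, Pi.single_apply]; split_ifs <;> simp
        · simp [sv]
    · rintro x ⟨hx, hx'⟩ y ⟨hy, hy'⟩ a b ha hb hab
      refine ⟨fun i => ?_, ?_⟩
      · have := hx i; have := hy i; simp; positivity
      · simp only [Pi.add_apply, Pi.smul_apply, smul_eq_mul, Finset.sum_add_distrib,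
          ← Finset.mul_sum]
        nlinarith
  · rintro x ⟨hx, hx'⟩
    refine mem_convexHull_of_exists_fintype (ι := Option (Fin n))
      (fun o => o.elim (1 - ∑ i, x i) x) (sv n) ?_ ?_ (fun i => ⟨i, rfl⟩) ?_
    · rintro (_ | i)
      · simpa using hx'
      · exact hx i
    · simp [Fintype.sum_option]
    · simp only [Fintype.sum_option, sv, Option.elim, smul_zero, zero_add]
      funext j
      simp [Pi.single_apply]

theorem vol_simp_set (n : ℕ) : ∀ t : ℝ, 0 ≤ t →
    volume (simp_set n t) = ENNReal.ofReal (t ^ n / n.factorial) := by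
  induction n with
  | zero =>
    intro t ht
    have : simp_set 0 t = Set.univ := by
      ext x; simp [simp_set, ht]
    rw [this]; simp [volume_pi, Measure.pi_of_empty]
  | succ n ih =>
    intro t ht
    have hmp := (volume_preserving_piFinSuccAbove (fun _ : Fin (n+1) => ℝ) 0).symm
    rw [← hmp.measure_preimage (simp_set_meas _ _).nullMeasurableSet]
    have hm := hmp.measurable (simp_set_meas (n+1) t)
    rw [Measure.volume_eq_prod, Measure.prod_apply hm]
    have hs : ∀ x : ℝ, volume (Prod.mk x ⁻¹'
        ((MeasurableEquiv.piFinSuccAbove (fun _ : Fin (n+1) => ℝ) 0).symm ⁻¹' simp_set (n+1) t)) =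
        (Set.Icc 0 t).indicator (fun x => ENNReal.ofReal ((t - x) ^ n / n.factorial)) x := by
      intro x
      by_cases hx : x ∈ Set.Icc 0 t
      · rw [Set.indicator_of_mem hx, ← ih _ (sub_nonneg.2 hx.2)]
        congr 1
        ext y
        simp only [Set.mem_preimage, simp_set, MeasurableEquiv.piFinSuccAbove_symm_apply,
          Set.mem_ofPred_eq, Fin.insertNthEquiv_apply, Fin.insertNth_zero, Fin.forall_fin_succ, Fin.sum_univ_succ,
          Fin.cons_zero, Fin.cons_succ, cast_eq]
        constructor
        · rintro ⟨⟨_, h⟩, h'⟩; exact ⟨h, by linarith⟩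
        · rintro ⟨h, h'⟩; exact ⟨⟨hx.1, h⟩, by linarith⟩
      · rw [Set.indicator_of_notMem hx]
        convert measure_empty (μ := volume)
        ext y
        simp only [Set.mem_preimage, simp_set, MeasurableEquiv.piFinSuccAbove_symm_apply,
          Set.mem_ofPred_eq, Fin.insertNthEquiv_apply, Fin.insertNth_zero, Fin.forall_fin_succ, Fin.sum_univ_succ,
          Fin.cons_zero, Fin.cons_succ, cast_eq, Set.mem_empty_iff_false, iff_false]
        rintro ⟨⟨h0, h⟩, h'⟩
        have := Finset.sum_nonneg (fun i (_ : i ∈ Finset.univ) => h i)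
        exact hx ⟨h0, by linarith⟩
    simp_rw [hs]
    rw [lintegral_indicator measurableSet_Icc, ← ofReal_integral_eq_lintegral_ofReal]
    · rw [integral_Icc_eq_integral_Ioc, ← intervalIntegral.integral_of_le ht]
      congr 1
      rw [intervalIntegral.integral_div, intervalIntegral.integral_comp_sub_left (fun x => x ^ n) t]
      rw [integral_pow]
      simp [Nat.factorial_succ]
      field_simp
    · exact (by fun_prop : Continuous _).integrableOn_Icc
    · refine (ae_restrict_iff' measurableSet_Icc).2 (Filter.Eventually.of_forall fun x hx => ?_)
      have := sub_nonneg.2 hx.2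
      simp only [Pi.zero_apply]; positivity

theorem vol_std (n : ℕ) : volume (stdSimplexPoly n) = ENNReal.ofReal (1 / n.factorial) := by
  rw [std_eq_set, vol_simp_set n 1 zero_le_one, one_pow]

theorem hull_option {E : Type*} [AddCommGroup E] [Module ℝ E] {i : ℕ} (s : Option (Fin i) → E) :
    convexHull ℝ (Set.range s) =
      (fun x : Fin i → ℝ => s none + ∑ l, x l • (s (some l) - s none)) '' stdSimplexPoly i := by
  let f : (Fin i → ℝ) →ᵃ[ℝ] E :=
    (Fintype.linearCombination ℝ (fun l => s (some l) - s none)).toAffineMap +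
      AffineMap.const ℝ _ (s none)
  have hf : (fun x : Fin i → ℝ => s none + ∑ l, x l • (s (some l) - s none)) = f := by
    funext x; simp [f, Fintype.linearCombination_apply, add_comm]
  rw [hf, std_eq_hull, AffineMap.image_convexHull, ← Set.range_comp]
  congr 2
  funext o
  rw [← hf]
  cases o with
  | none => simp [sv]
  | some l => simp [sv, Pi.single_apply]

def icast {n : ℕ} (v : Fin n → ℤ) : Fin n → ℝ := fun i => ((v i : ℤ) : ℝ)

theorem vol_prod_set {i j n : ℕ} (e : Fin i ⊕ Fin j ≃ Fin n) :
    volume {x : Fin n → ℝ | (fun l => x (e (Sum.inl l))) ∈ stdSimplexPoly i ∧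
      (fun l => x (e (Sum.inr l))) ∈ stdSimplexPoly j} =
    ENNReal.ofReal (1 / i.factorial) * ENNReal.ofReal (1 / j.factorial) := by
  have hi := std_eq_set i ▸ simp_set_meas i 1
  have hj := std_eq_set j ▸ simp_set_meas j 1
  have h1 := (volume_measurePreserving_piCongrLeft (fun _ : Fin n => ℝ) e).symm
  have h2 := volume_measurePreserving_sumPiEquivProdPi (fun _ : Fin i ⊕ Fin j => ℝ)
  have h3 := (h2.comp h1).measure_preimage (hi.prod hj).nullMeasurableSet
  rw [Measure.volume_eq_prod, Measure.prod_prod, vol_std, vol_std] at h3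
  rw [← h3]
  rfl

theorem vol_simplex_sum {i j n : ℕ} (hij : i + j = n) (s : Option (Fin i) → Fin n → ℤ)
    (g : Option (Fin j) → Fin n → ℤ) :
    ∃ z : ℤ, (n.factorial : ℝ) * (volume (convexHull ℝ (Set.range (fun o => icast (s o))) +
      convexHull ℝ (Set.range (fun o => icast (g o))))).toReal = (n.choose i : ℝ) * z := by
  let e : Fin i ⊕ Fin j ≃ Fin n := finSumFinEquiv.trans (finCongr hij)
  let M : Matrix (Fin n) (Fin n) ℤ := fun r q => Sum.elim (fun l => s (some l) r - s none r)
    (fun l => g (some l) r - g none r) (e.symm q)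
  let L := Matrix.toLin' (M.map (Int.cast : ℤ → ℝ))
  let T := {x : Fin n → ℝ | (fun l => x (e (Sum.inl l))) ∈ stdSimplexPoly i ∧
      (fun l => x (e (Sum.inr l))) ∈ stdSimplexPoly j}
  have hL : ∀ x, L x = (∑ l, x (e (Sum.inl l)) • (icast (s (some l)) - icast (s none))) +
      ∑ l, x (e (Sum.inr l)) • (icast (g (some l)) - icast (g none)) := by
    intro x
    funext r
    simp only [L, Matrix.toLin'_apply, Matrix.mulVec, dotProduct, Pi.add_apply, Finset.sum_apply]
    rw [← e.sum_comp, Fintype.sum_sum_type]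
    simp only [Matrix.map_apply]
    simp [M, icast, mul_comm]
  have hset : convexHull ℝ (Set.range (fun o => icast (s o))) +
      convexHull ℝ (Set.range (fun o => icast (g o))) =
      (icast (s none) + icast (g none)) +ᵥ (L '' T) := by
    rw [hull_option, hull_option]
    ext y
    constructor
    · rintro ⟨_, ⟨a, ha, rfl⟩, _, ⟨b, hb, rfl⟩, rfl⟩
      refine ⟨_, ⟨fun q => Sum.elim a b (e.symm q), ⟨?_, ?_⟩, rfl⟩, ?_⟩
      · simpa using ha
      · simpa using hb
      · simp only [hL, vadd_eq_add, Equiv.symm_apply_apply, Sum.elim_inl, Sum.elim_inr]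
        abel
    · rintro ⟨_, ⟨x, ⟨hx, hx'⟩, rfl⟩, rfl⟩
      refine ⟨_, ⟨_, hx, rfl⟩, _, ⟨_, hx', rfl⟩, ?_⟩
      simp only [hL, vadd_eq_add]
      abel
  refine ⟨|M.det|, ?_⟩
  have hdet : LinearMap.det L = (M.det : ℝ) := by
    rw [LinearMap.det_toLin']
    exact (Int.cast_det M).symm
  rw [hset, measure_vadd, Measure.addHaar_image_linearMap, vol_prod_set, hdet]
  rw [ENNReal.toReal_mul, ENNReal.toReal_mul, ENNReal.toReal_ofReal (abs_nonneg _),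
    ENNReal.toReal_ofReal (by positivity), ENNReal.toReal_ofReal (by positivity)]
  have hc : (n.choose i : ℝ) = n.factorial / (i.factorial * j.factorial) := by
    rw [← hij, Nat.choose_symm_add, Nat.add_choose]
    rw [Nat.cast_div (Nat.factorial_mul_factorial_dvd_factorial_add i j) (by positivity)]
    push_cast; rfl
  rw [hc]
  push_cast
  field_simp

end

section

theorem chart_vol {n : ℕ} (φ : (Fin n → ℝ) →ᵃ[ℝ] (Fin n → ℝ)) (hb : Function.Bijective φ)
    (hi : ∀ x, IsIntPt x ↔ IsIntPt (φ x)) (C : Set (Fin n → ℝ)) :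
    volume ((fun x => φ x) '' C) = volume C := by
  have hdec : ∀ x, φ x = φ.linear x + φ 0 := fun x => by
    have := congrFun (AffineMap.decomp φ) x
    simpa using this
  have hL : Function.Bijective φ.linear := (AffineMap.linear_bijective_iff φ).2 hb
  let L' := (LinearEquiv.ofBijective φ.linear hL).symm.toLinearMap
  have hL' : ∀ x, φ.linear (L' x) = x := fun x =>
    (LinearEquiv.ofBijective φ.linear hL).apply_symm_apply x
  have hz : IsIntPt (φ 0) := (hi 0).1 fun i => ⟨0, by simp⟩
  have hsing : ∀ j : Fin n, IsIntPt (Pi.single j (1 : ℝ)) := fun j i => by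
    by_cases h : i = j
    · subst h; exact ⟨1, by simp⟩
    · exact ⟨0, by simp [h]⟩
  have hadd : ∀ x y : Fin n → ℝ, IsIntPt x → IsIntPt y → IsIntPt (x + y) := fun x y hx hy i => by
    obtain ⟨a, ha⟩ := hx i
    obtain ⟨b, hb⟩ := hy i
    exact ⟨a + b, by simp [ha, hb]⟩
  have hsub : ∀ x y : Fin n → ℝ, IsIntPt x → IsIntPt y → IsIntPt (x - y) := fun x y hx hy i => by
    obtain ⟨a, ha⟩ := hx i
    obtain ⟨b, hb⟩ := hy i
    exact ⟨a - b, by simp [ha, hb]⟩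
  have hdetint : ∀ f : (Fin n → ℝ) →ₗ[ℝ] (Fin n → ℝ), (∀ j, IsIntPt (f (Pi.single j 1))) →
      ∃ d : ℤ, LinearMap.det f = d := by
    intro f hf
    choose A hA using hf
    refine ⟨Matrix.det (Matrix.of fun i j => A j i), ?_⟩
    rw [← LinearMap.det_toMatrix', Int.cast_det]
    congr 1
    ext i j
    rw [LinearMap.toMatrix'_apply]
    simp only [Matrix.map_apply]
    exact hA j i
  obtain ⟨d, hd⟩ := hdetint φ.linear (fun j => by
    have : φ.linear (Pi.single j 1) = φ (Pi.single j 1) - φ 0 := by rw [hdec (Pi.single j 1)]; simp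
    rw [this]
    exact hsub _ _ ((hi _).1 (hsing j)) hz)
  obtain ⟨d', hd'⟩ := hdetint L' (fun j => by
    rw [hi, hdec, hL']
    exact hadd _ _ (hsing j) hz)
  have hmul : LinearMap.det φ.linear * LinearMap.det L' = 1 := by
    rw [← LinearMap.det_comp]
    have : φ.linear ∘ₗ L' = LinearMap.id := LinearMap.ext hL'
    rw [this, LinearMap.det_id]
  rw [hd, hd'] at hmul
  have hu : d * d' = 1 := by exact_mod_cast hmul
  have habs : |(d : ℝ)| = 1 := by
    have : |d| = 1 := Int.isUnit_iff_abs_eq.1 (IsUnit.of_mul_eq_one _ hu)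
    exact_mod_cast this
  have himg : (fun x => φ x) '' C = φ 0 +ᵥ (φ.linear '' C) := by
    ext y
    constructor
    · rintro ⟨x, hx, rfl⟩
      exact ⟨_, ⟨x, hx, rfl⟩, by simp only [vadd_eq_add]; rw [hdec x, add_comm]⟩
    · rintro ⟨_, ⟨x, hx, rfl⟩, rfl⟩
      exact ⟨x, hx, by simp only [vadd_eq_add]; rw [hdec x, add_comm]⟩
  rw [himg, measure_vadd, Measure.addHaar_image_linearMap, hd, habs]
  simp

open Classical in
theorem normVol_of_dim {n r : ℕ} (P : Set (Fin n → ℝ)) (hr : polyDim P = r) :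
    normVol P = (Nat.factorial r) *
    (if h : ∃ φ : (Fin n → ℝ) →ᵃ[ℝ] (Fin r → ℝ), IsLatticeChart P φ
      then (volume ((fun x => h.choose x) '' P)).toReal
      else 0) := by
  subst hr; rfl

theorem span_top {n : ℕ} (C : Set (Fin n → ℝ)) (hC : C.Nonempty) (hd : polyDim C = n) :
    affineSpan ℝ C = ⊤ := by
  rw [← AffineSubspace.direction_eq_top_iff_of_nonempty ((affineSpan_nonempty ℝ).2 hC)]
  apply Submodule.eq_top_of_finrank_eq
  rw [← polyDim, hd]; simp

theorem normVol_full {n : ℕ} (C : Set (Fin n → ℝ)) (hC : C.Nonempty) (hd : polyDim C = n) :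
    normVol C = n.factorial * (volume C).toReal := by
  have hs := span_top C hC hd
  have hex : ∃ φ : (Fin n → ℝ) →ᵃ[ℝ] (Fin n → ℝ), IsLatticeChart C φ :=
    ⟨AffineMap.id ℝ _, by rw [hs]; exact Set.bijOn_id _, fun x _ => Iff.rfl⟩
  rw [normVol_of_dim C hd, dif_pos hex]
  have h := hex.choose_spec
  rw [chart_vol]
  · have := h.1
    rw [hs] at this
    exact Set.bijOn_univ.1 this
  · intro x
    exact h.2 x (by rw [hs]; trivial)

theorem vectorSpan_sum {n : ℕ} (s t : Set (Fin n → ℝ)) (hs : s.Nonempty) (ht : t.Nonempty) :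
    vectorSpan ℝ (s + t) = vectorSpan ℝ s ⊔ vectorSpan ℝ t := by
  apply le_antisymm
  · refine Submodule.span_le.2 ?_
    rintro _ ⟨_, ⟨a, ha, b, hb, rfl⟩, _, ⟨c, hc, d, hd, rfl⟩, rfl⟩
    have : (fun x1 x2 : Fin n → ℝ => x1 -ᵥ x2) ((fun x1 x2 => x1 + x2) a b)
        ((fun x1 x2 => x1 + x2) c d) = (a -ᵥ c) + (b -ᵥ d) := by
      simp only [vsub_eq_sub]; abel
    rw [this]
    exact Submodule.add_mem_sup (vsub_mem_vectorSpan ℝ ha hc) (vsub_mem_vectorSpan ℝ hb hd)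
  · refine sup_le (Submodule.span_le.2 ?_) (Submodule.span_le.2 ?_)
    · rintro _ ⟨a, ha, c, hc, rfl⟩
      obtain ⟨b, hb⟩ := ht
      have := vsub_mem_vectorSpan ℝ (Set.add_mem_add ha hb) (Set.add_mem_add hc hb)
      simpa using this
    · rintro _ ⟨a, ha, c, hc, rfl⟩
      obtain ⟨b, hb⟩ := hs
      have := vsub_mem_vectorSpan ℝ (Set.add_mem_add hb ha) (Set.add_mem_add hb hc)
      simpa using this

theorem polyDim_vs {n : ℕ} (s : Set (Fin n → ℝ)) :
    polyDim s = Module.finrank ℝ (vectorSpan ℝ s) := by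
  rw [polyDim, direction_affineSpan]

section prod
variable {n : ℕ} {ι κ : Type*} [Finite ι] [Finite κ] [Nonempty ι] [Nonempty κ]

def sumA (a : ι → Fin n → ℝ) (b : κ → Fin n → ℝ) : ι × κ → Fin n → ℝ := fun p => a p.1 + b p.2
def sumH (h : ι → ℝ) (g : κ → ℝ) : ι × κ → ℝ := fun p => h p.1 + g p.2

set_option linter.unusedSectionVars false

theorem hull_sumA (a : ι → Fin n → ℝ) (b : κ → Fin n → ℝ) :
    convexHull ℝ (Set.range (sumA a b)) =
      convexHull ℝ (Set.range a) + convexHull ℝ (Set.range b) := by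
  rw [← convexHull_add]
  congr 1
  ext x
  constructor
  · rintro ⟨p, rfl⟩
    exact ⟨_, ⟨p.1, rfl⟩, _, ⟨p.2, rfl⟩, rfl⟩
  · rintro ⟨_, ⟨i, rfl⟩, _, ⟨j, rfl⟩, rfl⟩
    exact ⟨(i, j), rfl⟩

theorem lcell_sumA (a : ι → Fin n → ℝ) (b : κ → Fin n → ℝ) (h : ι → ℝ) (g : κ → ℝ)
    (c : Fin n → ℝ) :
    lcell (sumA a b) (sumH h g) c = lcell a h c + lcell b g c := by
  have hact : ∀ p, p ∈ lact (sumA a b) (sumH h g) c ↔ p.1 ∈ lact a h c ∧ p.2 ∈ lact b g c := by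
    rintro ⟨i, j⟩
    simp only [lact, sumA, sumH, dotR_add, Set.mem_ofPred_eq, Prod.forall]
    constructor
    · intro H
      exact ⟨fun l => by linarith [H l j], fun l => by linarith [H i l]⟩
    · rintro ⟨H1, H2⟩ l m
      linarith [H1 l, H2 m]
  rw [lcell, lcell, lcell, ← convexHull_add]
  congr 1
  ext x
  constructor
  · rintro ⟨p, hp, rfl⟩
    rw [hact] at hp
    exact ⟨_, ⟨p.1, hp.1, rfl⟩, _, ⟨p.2, hp.2, rfl⟩, rfl⟩
  · rintro ⟨_, ⟨i, hi, rfl⟩, _, ⟨j, hj, rfl⟩, rfl⟩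
    exact ⟨(i, j), (hact _).2 ⟨hi, hj⟩, rfl⟩

theorem argmin_lcell (a : ι → Fin n → ℝ) (c w : Fin n → ℝ) :
    argminSet (c + w) (convexHull ℝ (Set.range a)) = lcell a (fun j => dotR w (a j)) c := by
  set h : ι → ℝ := fun j => dotR w (a j) with hh
  have hval : ∀ j, dotL (c + w) (a j) = h j + dotR c (a j) := fun j => by
    rw [dotL_apply, dotR_add_left, hh]; ring
  have key := hull_min_face (Set.range a) (dotL (c + w)) (lmin a h c) (by
    rintro _ ⟨j, rfl⟩
    rw [hval]; exact lmin_le a h c j)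
  have e : {y ∈ Set.range a | dotL (c + w) y = lmin a h c} = a '' lact a h c := by
    ext y
    constructor
    · rintro ⟨⟨j, rfl⟩, hj⟩
      rw [hval] at hj
      exact ⟨j, (mem_lact_iff a h c j).2 hj, rfl⟩
    · rintro ⟨j, hj, rfl⟩
      exact ⟨⟨j, rfl⟩, by rw [hval]; exact (mem_lact_iff a h c j).1 hj⟩
  have hge : ∀ y ∈ convexHull ℝ (Set.range a), lmin a h c ≤ dotR (c + w) y := by
    intro y hy
    have hc : Convex ℝ {y | lmin a h c ≤ dotL (c + w) y} :=
      convex_halfSpace_ge (dotL (c + w)).isLinear _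
    have := convexHull_min (s := Set.range a) (by
      rintro _ ⟨j, rfl⟩
      show _ ≤ dotL _ _
      rw [hval]; exact lmin_le a h c j) hc hy
    simpa [dotL_apply] using this
  rw [e] at key
  ext x
  rw [lcell, key, dotL_apply]
  constructor
  · rintro ⟨hx, hx'⟩
    refine ⟨hx, le_antisymm ?_ (hge x hx)⟩
    obtain ⟨j, hj⟩ := lact_nonempty a h c
    rw [← (mem_lact_iff a h c j).1 hj, ← hval, dotL_apply]
    exact hx' _ (subset_convexHull ℝ _ ⟨j, rfl⟩)
  · rintro ⟨hx, hx'⟩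
    exact ⟨hx, fun y hy => by rw [hx']; exact hge y hy⟩

theorem argmin_orth (c : Fin n → ℝ) (Q : Set (Fin n → ℝ)) (u : Fin n → ℝ)
    (hu : u ∈ vectorSpan ℝ (argminSet c Q)) : dotR c u = 0 := by
  have : vectorSpan ℝ (argminSet c Q) ≤ LinearMap.ker (dotL c) := by
    refine Submodule.span_le.2 ?_
    rintro _ ⟨x, hx, y, hy, rfl⟩
    show _ ∈ LinearMap.ker (dotL c)
    rw [LinearMap.mem_ker]
    simp only [vsub_eq_sub, map_sub, dotL_apply]
    exact sub_eq_zero.2 (le_antisymm (hx.2 y hy.1) (hy.2 x hx.1))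
  have := this hu
  rwa [LinearMap.mem_ker, dotL_apply] at this

theorem generic_heights (a : ι → Fin n → ℝ) :
    ∃ h : ι → ℝ, ∀ c, AffineIndependent ℝ (fun j : lact a h c => a j) := by
  classical
  have := Fintype.ofFinite ι
  have hex : ∀ T : {T : Set ι // ¬ AffineIndependent ℝ (fun j : T => a j)},
      ∃ α : ι → ℝ, α ≠ 0 ∧ (∀ j, j ∉ T.1 → α j = 0) ∧ ∑ j, α j = 0 ∧ ∑ j, α j • a j = 0 := by
    rintro ⟨T, hT⟩
    rw [affineIndependent_iff] at hT
    push Not at hT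
    obtain ⟨s, w, hw0, hw1, i, hi, hwi⟩ := hT
    let α : ι → ℝ := fun j => if h : j ∈ T then (if (⟨j, h⟩ : T) ∈ s then w ⟨j, h⟩ else 0) else 0
    have hαT : ∀ j, j ∉ T → α j = 0 := fun j hj => by simp [α, hj]
    have hα : ∀ j : T, α j = if j ∈ s then w j else 0 := fun j => by simp [α]
    have hsum : ∀ {E : Type} [AddCommGroup E] (g : ι → E), (∀ j, j ∉ T → g j = 0) →
        ∑ j, g j = ∑ j : T, g j := by
      intro E _ g hg
      rw [← Finset.sum_filter_of_ne (p := fun j => j ∈ T)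
        (fun j _ hj => by by_contra hn; exact hj (hg j hn))]
      exact Finset.sum_subtype _ (by simp) g
    refine ⟨α, ?_, hαT, ?_, ?_⟩
    · intro h0
      have := congrFun h0 i
      rw [hα, if_pos hi] at this
      exact hwi this
    · rw [hsum α hαT]
      simp_rw [hα]
      simpa using hw0
    · rw [hsum _ (fun j hj => by rw [hαT j hj, zero_smul])]
      simp_rw [hα, ite_smul, zero_smul]
      simpa using hw1
  choose α hα0 hαT hα1 hα2 using hex
  obtain ⟨f, hf⟩ := Module.exists_dual_forall_apply_ne_zero (K := ℝ) α hα0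
  refine ⟨fun j => f (Pi.single j 1), fun c => ?_⟩
  by_contra hcon
  set h : ι → ℝ := fun j => f (Pi.single j 1) with hh
  let T : {T : Set ι // ¬ AffineIndependent ℝ (fun j : T => a j)} := ⟨lact a h c, hcon⟩
  apply hf T
  have e1 : f (α T) = ∑ j, α T j * h j := by
    rw [LinearMap.pi_apply_eq_sum_univ f (α T)]
    refine Finset.sum_congr rfl fun j _ => ?_
    rw [smul_eq_mul, hh]
    congr 2
    funext k
    simp [Pi.single_apply, eq_comm]
  have e2 : ∀ j, α T j * h j = α T j * lmin a h c - dotL c (α T j • a j) := by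
    intro j
    by_cases hj : j ∈ lact a h c
    · have := (mem_lact_iff a h c j).1 hj
      rw [map_smul, dotL_apply, smul_eq_mul, ← this]; ring
    · rw [hαT T j hj]; simp
  rw [e1]
  simp_rw [e2]
  rw [Finset.sum_sub_distrib, ← Finset.sum_mul, hα1 T, ← map_sum, hα2 T]
  simp

end prod

end

section

theorem vs_hull {n : ℕ} (s : Set (Fin n → ℝ)) :
    vectorSpan ℝ (convexHull ℝ s) = vectorSpan ℝ s := by
  rw [← direction_affineSpan, affineSpan_convexHull, direction_affineSpan]

theorem sv_indep (n : ℕ) : AffineIndependent ℝ (sv n) := by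
  rw [affineIndependent_iff_of_fintype]
  intro w hw hs
  rw [Finset.weightedVSub_eq_linear_combination _ hw] at hs
  have h1 : ∀ i, w (some i) = 0 := by
    intro i
    have := congrFun hs i
    simpa [Fintype.sum_option, sv, Pi.single_apply] using this
  rintro (_ | i)
  · simpa [Fintype.sum_option, h1] using hw
  · exact h1 i

theorem mixed_vol {n i j : ℕ} {ι κ : Type*} [Finite ι] [Finite κ] [Nonempty ι] [Nonempty κ]
    (v : ι → Fin n → ℤ) (g : κ → Fin n → ℤ)
    (hg : AffineIndependent ℝ (fun l => icast (g l)))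
    (hij : i + j = n)
    (hi : Module.finrank ℝ (vectorSpan ℝ (Set.range (fun l => icast (v l)))) = i)
    (hj : Module.finrank ℝ (vectorSpan ℝ (Set.range (fun l => icast (g l)))) = j)
    (hspan : affineSpan ℝ (convexHull ℝ (Set.range (fun l => icast (v l))) +
      convexHull ℝ (Set.range (fun l => icast (g l)))) = ⊤) :
    ∃ z : ℤ, (n.factorial : ℝ) * (volume (convexHull ℝ (Set.range (fun l => icast (v l))) +
      convexHull ℝ (Set.range (fun l => icast (g l))))).toReal = (n.choose i : ℝ) * z := by
  classical
  set a : ι → Fin n → ℝ := fun l => icast (v l) with ha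
  set b : κ → Fin n → ℝ := fun l => icast (g l) with hb
  obtain ⟨h, hh⟩ := generic_heights a
  let h2 : κ → ℝ := fun _ => 0
  rw [← hull_sumA] at hspan ⊢
  have hint : (interior (convexHull ℝ (Set.range (sumA a b)))).Nonempty :=
    (Convex.interior_nonempty_iff_affineSpan_eq_top (convex_convexHull ℝ _)).2 hspan
  rw [volume_cells (sumA a b) (sumH h h2) hint]
  have hcell : ∀ C ∈ (lcell_range_finite (sumA a b) (sumH h h2)).toFinset,
      ∃ z : ℤ, (n.factorial : ℝ) * (volume C).toReal = (n.choose i : ℝ) * z := by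
    intro C hC
    obtain ⟨c, rfl⟩ := (Set.Finite.mem_toFinset _).1 hC
    by_cases hv : volume (lcell (sumA a b) (sumH h h2) c) = 0
    · exact ⟨0, by rw [hv]; simp⟩
    have htop : affineSpan ℝ (lcell (sumA a b) (sumH h h2) c) = ⊤ := by
      by_contra hne
      exact hv (measure_mono_null (subset_affineSpan ℝ _)
        (Measure.addHaar_affineSubspace volume _ hne))
    rw [lcell_sumA] at htop ⊢
    have hvs : vectorSpan ℝ (lcell a h c) ⊔ vectorSpan ℝ (lcell b h2 c) = ⊤ := by
      rw [← vectorSpan_sum _ _ (lcell_nonempty a h c) (lcell_nonempty b h2 c),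
        ← direction_affineSpan, htop, AffineSubspace.direction_top]
    have hfr := Submodule.finrank_add_le_finrank_add_finrank (vectorSpan ℝ (lcell a h c))
      (vectorSpan ℝ (lcell b h2 c))
    rw [hvs, finrank_top, Module.finrank_fin_fun] at hfr
    let T1 := lact a h c
    let T2 := lact b h2 c
    have e1 : lcell a h c = convexHull ℝ (Set.range (fun l : T1 => a l)) := by
      rw [lcell, Set.image_eq_range]
    have e2 : lcell b h2 c = convexHull ℝ (Set.range (fun l : T2 => b l)) := by
      rw [lcell, Set.image_eq_range]
    rw [e1, e2, vs_hull, vs_hull] at hfr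
    have m1 : Module.finrank ℝ (vectorSpan ℝ (Set.range (fun l : T1 => a l))) ≤ i := by
      rw [← hi]
      exact Submodule.finrank_mono (vectorSpan_mono ℝ (by rintro _ ⟨l, rfl⟩; exact ⟨l, rfl⟩))
    have m2 : Module.finrank ℝ (vectorSpan ℝ (Set.range (fun l : T2 => b l))) ≤ j := by
      rw [← hj]
      exact Submodule.finrank_mono (vectorSpan_mono ℝ (by rintro _ ⟨l, rfl⟩; exact ⟨l, rfl⟩))
    have := Fintype.ofFinite T1
    have := Fintype.ofFinite T2
    have n1 : Nonempty T1 := (lact_nonempty a h c).to_subtype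
    have n2 : Nonempty T2 := (lact_nonempty b h2 c).to_subtype
    have c1 := AffineIndependent.finrank_vectorSpan_add_one (hh c)
    have c2 := AffineIndependent.finrank_vectorSpan_add_one
      (hg.comp_embedding (Function.Embedding.subtype (· ∈ T2)))
    change Module.finrank ℝ (vectorSpan ℝ (Set.range (fun l : T1 => a l))) + 1 = _ at c1
    change Module.finrank ℝ (vectorSpan ℝ (Set.range (fun l : T2 => b l))) + 1 =
      Fintype.card T2 at c2
    have k1 : Fintype.card (Option (Fin i)) = Fintype.card T1 := by
      rw [← c1]; simp; omega
    have k2 : Fintype.card (Option (Fin j)) = Fintype.card T2 := by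
      rw [← c2]; simp; omega
    let q1 := Fintype.equivOfCardEq k1
    let q2 := Fintype.equivOfCardEq k2
    have r1 : Set.range (fun l : T1 => a l) = Set.range (fun o => icast (v (q1 o))) :=
      (q1.surjective.range_comp (fun l : T1 => a l)).symm
    have r2 : Set.range (fun l : T2 => b l) = Set.range (fun o => icast (g (q2 o))) :=
      (q2.surjective.range_comp (fun l : T2 => b l)).symm
    rw [e1, e2, r1, r2]
    exact vol_simplex_sum hij (fun o => v (q1 o)) (fun o => g (q2 o))
  choose! z hz using hcell
  refine ⟨∑ C ∈ (lcell_range_finite (sumA a b) (sumH h h2)).toFinset, z C, ?_⟩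
  rw [ENNReal.toReal_sum, Finset.mul_sum, Finset.sum_congr rfl hz, ← Finset.mul_sum]
  · push_cast; rfl
  · intro C hC
    obtain ⟨c, rfl⟩ := (Set.Finite.mem_toFinset _).1 hC
    exact (lcell_compact _ _ c).measure_ne_top

theorem exists_generic_w {n : ℕ} {ι κ : Type*} [Finite ι] [Finite κ] [Nonempty ι] [Nonempty κ]
    (a : ι → Fin n → ℝ) (b : κ → Fin n → ℝ) :
    ∃ w : Fin n → ℝ, ∀ c, vectorSpan ℝ (lcell a (fun j => dotR 0 (a j)) c) ⊓
      vectorSpan ℝ (lcell b (fun j => dotR w (b j)) c) = ⊥ := by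
  classical
  let sp : Set ι × Set κ → Submodule ℝ (Fin n → ℝ) := fun S =>
    vectorSpan ℝ (convexHull ℝ (a '' S.1)) ⊓ vectorSpan ℝ (convexHull ℝ (b '' S.2))
  have hex : ∀ S : {S : Set ι × Set κ // sp S ≠ ⊥}, ∃ u, u ≠ 0 ∧ u ∈ sp S.1 := by
    rintro ⟨S, hS⟩
    obtain ⟨u, hu, hu0⟩ := Submodule.exists_mem_ne_zero_of_ne_bot hS
    exact ⟨u, hu0, hu⟩
  choose u hu0 hu using hex
  obtain ⟨f, hf⟩ := Module.exists_dual_forall_apply_ne_zero (K := ℝ) u hu0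
  obtain ⟨w, hw⟩ := exists_dotR_of_linear f
  refine ⟨w, fun c => ?_⟩
  by_contra hcon
  let S : {S : Set ι × Set κ // sp S ≠ ⊥} :=
    ⟨(lact a (fun j => dotR 0 (a j)) c, lact b (fun j => dotR w (b j)) c), hcon⟩
  apply hf S
  have h1 : u S ∈ vectorSpan ℝ (lcell a (fun j => dotR 0 (a j)) c) := (hu S).1
  have h2 : u S ∈ vectorSpan ℝ (lcell b (fun j => dotR w (b j)) c) := (hu S).2
  rw [← argmin_lcell] at h1 h2
  have := argmin_orth _ _ _ h1
  have := argmin_orth _ _ _ h2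
  rw [hw]
  simp only [dotR_add_left] at *
  have h0 : dotR 0 (u S) = 0 := by simp [dotR]
  linarith

theorem std_vs (n : ℕ) : vectorSpan ℝ (stdSimplexPoly n) = ⊤ := by
  rw [std_eq_hull, vs_hull]
  exact (sv_indep n).vectorSpan_eq_top_of_card_eq_finrank_add_one (by simp)

theorem std_nonempty (n : ℕ) : (stdSimplexPoly n).Nonempty := by
  rw [std_eq_hull]; exact (Set.range_nonempty _).convexHull

theorem std_dim (n : ℕ) : polyDim (stdSimplexPoly n) = n := by
  rw [polyDim_vs, std_vs]; simp

theorem dim_zero_singleton {n : ℕ} (F : Set (Fin n → ℝ)) (hF : F.Nonempty) (h : polyDim F = 0) :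
    ∃ v, F = {v} := by
  obtain ⟨v, hv⟩ := hF
  refine ⟨v, Set.eq_singleton_iff_unique_mem.2 ⟨hv, fun x hx => ?_⟩⟩
  rw [polyDim_vs, Submodule.finrank_eq_zero] at h
  have := vsub_mem_vectorSpan ℝ hx hv
  rw [h, Submodule.mem_bot, vsub_eq_zero_iff_eq] at this
  exact this

theorem dim_add_singleton {n : ℕ} (F : Set (Fin n → ℝ)) (hF : F.Nonempty) (v : Fin n → ℝ) :
    polyDim ({v} + F) = polyDim F := by
  rw [polyDim_vs, polyDim_vs, vectorSpan_sum _ _ (Set.singleton_nonempty v) hF,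
    vectorSpan_singleton, bot_sup_eq]

theorem normVol_translate {n : ℕ} (F : Set (Fin n → ℝ)) (hF : F.Nonempty) (hd : polyDim F = n)
    (v : Fin n → ℝ) : normVol ({v} + F) = normVol F := by
  rw [normVol_full F hF hd, normVol_full _ ((Set.singleton_nonempty v).add hF)
    ((dim_add_singleton F hF v).trans hd)]
  congr 2
  have : {v} + F = v +ᵥ F := by
    rw [Set.singleton_add]; rfl
  rw [this, measure_vadd]

theorem normVol_std (n : ℕ) : normVol (stdSimplexPoly n) = 1 := by
  rw [normVol_full _ (std_nonempty n) (std_dim n), vol_std,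
    ENNReal.toReal_ofReal (by positivity)]
  field_simp

theorem argmin_zero_dir {n : ℕ} (c : Fin n → ℝ) (Q : Set (Fin n → ℝ))
    (h : polyDim (argminSet c Q) = n) : c = 0 := by
  apply dotR_eq_zero
  intro x
  apply argmin_orth c Q
  rw [polyDim_vs] at h
  rw [Submodule.eq_top_of_finrank_eq (h.trans (by simp))]
  trivial

def svZ (n : ℕ) : Option (Fin n) → Fin n → ℤ
  | none => 0
  | some i => Pi.single i 1

theorem icast_svZ (n : ℕ) (o : Option (Fin n)) : icast (svZ n o) = sv n o := by
  cases o with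
  | none => funext i; simp [icast, svZ, sv]
  | some j =>
    funext i
    by_cases h : i = j
    · subst h; simp [icast, svZ, sv]
    · simp [icast, svZ, sv, h]

end

theorem mixed_even (k n : ℕ) (hnk : n = 2 ^ k) {ι : Type*} [Finite ι] [Nonempty ι] (v : ι → Fin n → ℤ)
    (S : Set ι) (T : Set (Option (Fin n))) (hS : S.Nonempty) (hT : T.Nonempty)
    (F G : Set (Fin n → ℝ))
    (hF : F = convexHull ℝ ((fun l => icast (v l)) '' S))
    (hG : G = convexHull ℝ (sv n '' T))
    (hd : polyDim (F + G) = n) (hs : polyDim F + polyDim G = n)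
    (h0 : polyDim F ≠ 0) (h1 : polyDim F ≠ n) : EvenVol (F + G) := by
  have hFn : F.Nonempty := by rw [hF]; exact (hS.image _).convexHull
  have hGn : G.Nonempty := by rw [hG]; exact (hT.image _).convexHull
  have := hS.to_subtype
  have := hT.to_subtype
  have hF' : F = convexHull ℝ (Set.range (fun l : S => icast (v l))) := by
    rw [hF, Set.image_eq_range]
  have hG' : G = convexHull ℝ (Set.range (fun l : T => icast (svZ n l))) := by
    rw [hG, Set.image_eq_range]; simp only [icast_svZ]
  have hg : AffineIndependent ℝ (fun l : T => icast (svZ n l)) := by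
    simp only [icast_svZ]
    exact (sv_indep n).comp_embedding (Function.Embedding.subtype _)
  obtain ⟨z, hz⟩ := mixed_vol (fun l : S => v l) (fun l : T => svZ n l) hg hs
    (by rw [← vs_hull, ← hF', polyDim_vs]) (by rw [← vs_hull, ← hG', polyDim_vs])
    (by rw [← hF', ← hG']; exact span_top _ (hFn.add hGn) hd)
  rw [← hF', ← hG'] at hz
  obtain ⟨m, hm⟩ := Nat.Prime.dvd_choose_pow Nat.prime_two h0 (by rw [← hnk]; exact h1)
  rw [← hnk] at hm
  refine ⟨m * z, ?_⟩
  rw [normVol_full _ (hFn.add hGn) hd, hz, hm]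
  push_cast
  ring

theorem argmin_zero {n : ℕ} (Q : Set (Fin n → ℝ)) : argminSet 0 Q = Q := by
  ext x; simp [argminSet, dotR]

theorem polyDim_le {n : ℕ} (Q : Set (Fin n → ℝ)) : polyDim Q ≤ n := by
  rw [polyDim_vs]; exact (Submodule.finrank_le _).trans (by simp)

theorem normVol_tr_std (n : ℕ) (u : Fin n → ℝ) : normVol ({u} + stdSimplexPoly n) = 1 := by
  rw [normVol_translate (stdSimplexPoly n) (std_nonempty n) (std_dim n) u]
  exact normVol_std n

theorem core_thm (k n : ℕ) (hnk : n = 2 ^ k) (P : Set (Fin n → ℝ))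
    (hP : InQclass k P) :
    ∃ 𝒞 : Finset (Set (Fin n → ℝ)),
      IsSubdivision (P + stdSimplexPoly n) 𝒞 ∧
      (∀ C ∈ 𝒞, polyDim C = polyDim (P + stdSimplexPoly n) →
        ∃ F G, IsFace P F ∧ IsFace (stdSimplexPoly n) G ∧ C = F + G ∧
          polyDim C = polyDim F + polyDim G) ∧
      ∃ C₀ ∈ 𝒞, polyDim C₀ = polyDim (P + stdSimplexPoly n) ∧
        (∃ F G, IsFace P F ∧ IsFace (stdSimplexPoly n) G ∧
          polyDim F = 0 ∧ polyDim G = n ∧ C₀ = F + G) ∧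
        (∃ v : Fin n → ℝ, C₀ = (fun x => v + x) '' stdSimplexPoly n) ∧
        normVol C₀ = 1 ∧
        ∀ C ∈ 𝒞, polyDim C = polyDim (P + stdSimplexPoly n) →
          ((∃ F G, IsFace P F ∧ IsFace (stdSimplexPoly n) G ∧
            polyDim F = 0 ∧ polyDim G = n ∧ C = F + G) → C = C₀) ∧
          (C ≠ C₀ → EvenVol C) := by
  classical
  obtain ⟨⟨V, hV, hPV⟩, hQ⟩ := hP
  have : Nonempty V := hV.to_subtype
  obtain ⟨a, ha⟩ : ∃ a : V → Fin n → ℝ, a = fun l => icast l.1 := ⟨_, rfl⟩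
  obtain ⟨b, hb⟩ : ∃ b, b = sv n := ⟨_, rfl⟩
  have hPa : P = convexHull ℝ (Set.range a) := by
    rw [hPV, Set.image_eq_range, ha]; rfl
  have hD : stdSimplexPoly n = convexHull ℝ (Set.range b) := by rw [hb]; exact std_eq_hull _
  have hΔn : (stdSimplexPoly n).Nonempty := std_nonempty _
  have hΔd : polyDim (stdSimplexPoly n) = n := std_dim _
  have hΔv : vectorSpan ℝ (stdSimplexPoly n) = ⊤ := std_vs _
  have hnv : ∀ u : Fin n → ℝ, normVol ({u} + stdSimplexPoly n) = 1 := normVol_tr_std n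
  generalize stdSimplexPoly n = Δ at *
  have hPn : P.Nonempty := by rw [hPa]; exact (Set.range_nonempty _).convexHull
  obtain ⟨w, hw⟩ := exists_generic_w a b
  obtain ⟨h1, hh1⟩ : ∃ h : V → ℝ, h = fun j => dotR 0 (a j) := ⟨_, rfl⟩
  obtain ⟨h2, hh2⟩ : ∃ h : Option (Fin n) → ℝ, h = fun j => dotR w (b j) := ⟨_, rfl⟩
  rw [← hh1, ← hh2] at hw
  have hsumd : polyDim (P + Δ) = n := by
    rw [polyDim_vs, vectorSpan_sum _ _ hPn hΔn, hΔv, sup_top_eq, finrank_top, Module.finrank_fin_fun]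
  have hsum : P + Δ = convexHull ℝ (Set.range (sumA a b)) := by rw [hull_sumA, hPa, hD]
  have hint : (interior (convexHull ℝ (Set.range (sumA a b)))).Nonempty := by
    rw [(convex_convexHull ℝ _).interior_nonempty_iff_affineSpan_eq_top, ← hsum]
    exact span_top _ (hPn.add hΔn) hsumd
  have hcell := lcell_sumA a b h1 h2
  have hFf : ∀ c, lcell a h1 c = argminSet c P := by
    intro c; rw [hPa, hh1, ← argmin_lcell, add_zero]
  have hGf : ∀ c, lcell b h2 c = argminSet (c + w) Δ := by
    intro c; rw [hD, argmin_lcell, hh2]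
  have hdim : ∀ c, polyDim (lcell a h1 c + lcell b h2 c) =
      polyDim (lcell a h1 c) + polyDim (lcell b h2 c) := by
    intro c
    have := Submodule.finrank_sup_add_finrank_inf_eq
      (vectorSpan ℝ (lcell a h1 c)) (vectorSpan ℝ (lcell b h2 c))
    rw [hw c, finrank_bot, add_zero] at this
    rw [polyDim_vs, polyDim_vs, polyDim_vs,
      vectorSpan_sum _ _ (lcell_nonempty a h1 c) (lcell_nonempty b h2 c), this]
  have hFface : ∀ c, IsFace P (lcell a h1 c) := fun c => Or.inr ⟨c, hFf c⟩
  have hGface : ∀ c, IsFace Δ (lcell b h2 c) := fun c => Or.inr ⟨c + w, hGf c⟩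
  have hG0 : lcell b h2 (-w) = Δ := by rw [hGf, neg_add_cancel, argmin_zero]
  have hF0 : polyDim (lcell a h1 (-w)) = 0 := by
    have e1 := hdim (-w)
    have e2 := polyDim_le (lcell a h1 (-w) + lcell b h2 (-w))
    have e3 : polyDim (lcell b h2 (-w)) = n := by rw [hG0]; exact hΔd
    omega
  obtain ⟨v, hv⟩ := dim_zero_singleton _ (lcell_nonempty a h1 (-w)) hF0
  have hC0 : lcell (sumA a b) (sumH h1 h2) (-w) = {v} + Δ := by rw [hcell, hv, hG0]
  have hC0d : polyDim ({v} + Δ) = n := (dim_add_singleton _ hΔn v).trans hΔd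
  have heven : ∀ c, polyDim (lcell (sumA a b) (sumH h1 h2) c) = n →
      lcell (sumA a b) (sumH h1 h2) c ≠ {v} + Δ →
      EvenVol (lcell (sumA a b) (sumH h1 h2) c) := by
    intro c hc hne
    have hs := hdim c
    have hFn := lcell_nonempty a h1 c
    have hGn := lcell_nonempty b h2 c
    rw [hcell] at hc hne ⊢
    rw [hc] at hs
    by_cases i0 : polyDim (lcell a h1 c) = 0
    · exfalso
      rw [i0, zero_add] at hs
      have hz := argmin_zero_dir (c + w) Δ (by rw [← hGf]; exact hs.symm)
      have : c = -w := eq_neg_of_add_eq_zero_left hz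
      apply hne
      rw [this, hv, hG0]
    by_cases i1 : polyDim (lcell a h1 c) = n
    · have g0 : polyDim (lcell b h2 c) = 0 := by omega
      obtain ⟨g, hg⟩ := dim_zero_singleton _ hGn g0
      obtain ⟨m, hm⟩ := hQ _ (hFface c) (by rw [← hnk]; exact i1.ge)
      refine ⟨m, ?_⟩
      rw [hg, add_comm, normVol_translate _ hFn i1, hm]
    · exact mixed_even k n hnk (fun l : V => l.1) (lact a h1 c) (lact b h2 c)
        (lact_nonempty a h1 c) (lact_nonempty b h2 c) _ _ (by rw [lcell, ha])
        (by rw [lcell, hb]) hc hs.symm i0 i1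
  obtain ⟨𝒞, h𝒞⟩ : ∃ 𝒞 : Finset (Set (Fin n → ℝ)),
      ∀ C, C ∈ 𝒞 ↔ C ∈ Set.range (lcell (sumA a b) (sumH h1 h2)) :=
    ⟨(lcell_range_finite (sumA a b) (sumH h1 h2)).toFinset, fun C => Set.Finite.mem_toFinset _⟩
  refine ⟨𝒞, ⟨?_, ?_, ?_⟩, ?_,
    {v} + Δ, ?_, ?_, ?_, ?_, ?_, ?_⟩
  · intro C hC
    rw [h𝒞] at hC
    obtain ⟨c, rfl⟩ := hC
    exact lcell_polytope _ _ c
  · simp only [h𝒞]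
    rw [cover_all _ _ hint, hsum]
  · intro C hC D hD
    rw [h𝒞] at hC hD
    obtain ⟨c, rfl⟩ := hC
    obtain ⟨d, rfl⟩ := hD
    refine ⟨lcell_face _ _ c d, ?_⟩
    rw [Set.inter_comm]
    exact lcell_face _ _ d c
  · intro C hC _
    rw [h𝒞] at hC
    obtain ⟨c, rfl⟩ := hC
    exact ⟨lcell a h1 c, lcell b h2 c, hFface c, hGface c, hcell c, by rw [hcell, hdim]⟩
  · rw [h𝒞]
    exact ⟨-w, hC0⟩
  · rw [hC0d, hsumd]
  · refine ⟨{v}, Δ, ?_, ?_, ?_, hΔd, rfl⟩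
    · rw [← hv]; exact hFface _
    · exact Or.inr ⟨0, (argmin_zero _).symm⟩
    · rw [← hv]; exact hF0
  · exact ⟨v, by rw [Set.singleton_add]⟩
  · exact hnv v
  · intro C hC hCd
    rw [h𝒞] at hC
    obtain ⟨c, rfl⟩ := hC
    rw [hsumd] at hCd
    refine ⟨?_, heven c hCd⟩
    rintro ⟨F, G, hF, hG, hFd, hGd, hFG⟩
    by_contra hne
    obtain ⟨m, hm⟩ := heven c hCd hne
    have hCn := lcell_nonempty (sumA a b) (sumH h1 h2) c
    rw [hFG] at hCn hm
    obtain ⟨u, rfl⟩ := dim_zero_singleton F hCn.of_add_left hFd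
    have hGΔ : G = Δ := by
      rcases hG with hG | ⟨c', hG⟩
      · exact absurd hG hCn.of_add_right.ne_empty
      · have hz := argmin_zero_dir c' Δ (by rw [← hG]; exact hGd)
        rw [hG, hz, argmin_zero]
    rw [hGΔ, hnv] at hm
    have : (1 : ℤ) = 2 * m := by exact_mod_cast hm
    omega

/-- For `P ∈ Q_k` in `ℝ^n` with `n = 2^k`, there is a subdivision of `P + Δ^n_0` into
affine products of faces of `P` and faces of `Δ^n_0` containing exactly one
full-dimensional cell which is an affine product of a `0`-dimensional face of `P` and a
`2^k`-dimensional face of `Δ^n_0`; this cell is a translate of `Δ^n_0` of normalized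
volume `1`, and every other full-dimensional cell has even normalized volume. -/
theorem unique_odd_cell_in_subdivision (k : ℕ) (P : Set (Fin (2 ^ k) → ℝ))
    (hP : InQclass k P) :
    ∃ 𝒞 : Finset (Set (Fin (2 ^ k) → ℝ)),
      IsSubdivision (P + stdSimplexPoly (2 ^ k)) 𝒞 ∧
      (∀ C ∈ 𝒞, polyDim C = polyDim (P + stdSimplexPoly (2 ^ k)) →
        ∃ F G, IsFace P F ∧ IsFace (stdSimplexPoly (2 ^ k)) G ∧ C = F + G ∧
          polyDim C = polyDim F + polyDim G) ∧
      ∃ C₀ ∈ 𝒞, polyDim C₀ = polyDim (P + stdSimplexPoly (2 ^ k)) ∧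
        (∃ F G, IsFace P F ∧ IsFace (stdSimplexPoly (2 ^ k)) G ∧
          polyDim F = 0 ∧ polyDim G = 2 ^ k ∧ C₀ = F + G) ∧
        (∃ v : Fin (2 ^ k) → ℝ, C₀ = (fun x => v + x) '' stdSimplexPoly (2 ^ k)) ∧
        normVol C₀ = 1 ∧
        ∀ C ∈ 𝒞, polyDim C = polyDim (P + stdSimplexPoly (2 ^ k)) →
          ((∃ F G, IsFace P F ∧ IsFace (stdSimplexPoly (2 ^ k)) G ∧
            polyDim F = 0 ∧ polyDim G = 2 ^ k ∧ C = F + G) → C = C₀) ∧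
          (C ≠ C₀ → EvenVol C) := by
  exact core_thm k (2 ^ k) rfl P hP

end
end
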